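/- arXiv:1106.2333 — 5 statements merged into one kernel-verified Lean document; each statement's English description precedes it below -/
import Mathlib

section
/- Let λ, χ, ψ ∈ ℝ satisfy: (χ ≥ 0 and ψ > 0) if λ > 0; (χ > 0 and ψ > 0) if λ = 0; (χ > 0 and ψ ≥ 0) if λ < 0. Let μ, β ∈ ℝ with β² + ψ > 0 or λ < 1/2, and define f : ℝ → [0,∞] by f(y) = ∫₀^∞ (2πx)^{-1/2} · exp(−(y − μ − βx)²/(2x)) · x^{λ−1} exp(−(χ/x + ψx)/2) dx. Then f is log-concave on ℝ if and only if λ ≥ 1. -/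
open MeasureTheory Set Real ENNReal

lemma lc_iff {a b c θ : ℝ} (ha : 0 < a) (hb : 0 < b) (hc : 0 < c) :
    ENNReal.ofReal a ^ θ * ENNReal.ofReal b ^ (1 - θ) ≤ ENNReal.ofReal c ↔
    θ * Real.log a + (1 - θ) * Real.log b ≤ Real.log c := by
  rw [ENNReal.ofReal_rpow_of_pos ha, ENNReal.ofReal_rpow_of_pos hb,
    ← ENNReal.ofReal_mul (by positivity), ENNReal.ofReal_le_ofReal_iff hc.le,
    ← Real.log_le_log_iff (by positivity) hc, Real.log_mul (by positivity) (by positivity),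
    Real.log_rpow ha, Real.log_rpow hb]

lemma contra_lemma (D : ℝ → ℝ) (b T C k C' k' : ℝ) (hT : 1 ≤ T) (hk : 0 < k) 
    (hD : ConcaveOn ℝ (Ici T) D)
    (hu : ∀ t ≥ T, D t ≤ -b * t + C - k * Real.log t)
    (hl : ∀ t ≥ T, -b * t - C' - k' * Real.log t ≤ D t) : False := by
  set L : ℝ → ℝ := fun t => D t + b * t with hL
  have hLc : ConcaveOn ℝ (Ici T) L := by
    refine hD.add ?_
    exact ⟨convex_Ici T, fun x _ y _ a c _ _ _ => by simp only [smul_eq_mul]; linarith⟩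
  -- pick t1
  obtain ⟨t1, h1, h2⟩ : ∃ t1, T < t1 ∧ L t1 < L T := by
    have := (Real.tendsto_log_atTop.eventually_gt_atTop ((C - L T) / k)).and
      (Filter.eventually_gt_atTop T)
    obtain ⟨t, ht, ht'⟩ := this.exists
    refine ⟨t, ht', ?_⟩
    have := hu t ht'.le
    rw [div_lt_iff₀ hk] at ht
    simp only [hL] at ht ⊢
    linarith
  set s := (L t1 - L T) / (t1 - T) with hs
  have hs0 : s < 0 := div_neg_of_neg_of_pos (by linarith) (by linarith)
  have key : ∀ t > t1, L t ≤ L T + s * (t - T) := by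
    intro t ht
    have := hLc.slope_anti_adjacent (x := T) (y := t1) (z := t) (by simp)
      (by simp only [mem_Ici]; linarith) h1 ht
    rw [div_le_iff₀ (by linarith)] at this
    have h5 : s * (t1 - T) = L t1 - L T := div_mul_cancel₀ _ (by linarith)
    linarith
  -- contradiction
  have h3 : Filter.Tendsto (fun t : ℝ => (-C' - L T) / t - k' * (Real.log t / t) + s * (T/ t))
      Filter.atTop (nhds (0 - k' * 0 + s * 0)) := by
    refine ((tendsto_const_nhds.div_atTop Filter.tendsto_id).sub (Filter.Tendsto.const_mul _ ?_)).add (Filter.Tendsto.const_mul _ (tendsto_const_nhds.div_atTop Filter.tendsto_id))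
    exact Real.isLittleO_log_id_atTop.tendsto_div_nhds_zero
  have h4 := h3.eventually (lt_mem_nhds (a := s) (by simpa using hs0))
  obtain ⟨t, h5, h6⟩ := (h4.and (Filter.eventually_gt_atTop t1)).exists
  have htp : 0 < t := by linarith
  have h7 := key t h6
  have h8 := hl t (by linarith)
  have h9 : (-C' - L T) / t - k' * (Real.log t / t) + s * (T/ t) = (-C' - L T - k' * Real.log t + s * T) / t := by
    field_simp
  rw [h9, lt_div_iff₀ htp] at h5
  simp only [hL] at *
  linarith

noncomputable def Gi (p a s : ℝ) : ℝ := ∫ x in Ioi (0:ℝ), x ^ (p - 1) * Real.exp (-s / x - a * x)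

lemma Gi_meas (p a s : ℝ) : Measurable (fun x : ℝ => x ^ (p - 1) * Real.exp (-s / x - a * x)) := by
  fun_prop

lemma int0 {p a : ℝ} (hp : 0 < p) (ha : 0 < a) :
    IntegrableOn (fun x : ℝ => x ^ (p - 1) * Real.exp (- a * x)) (Ioi 0) := by
  have := integrableOn_rpow_mul_exp_neg_mul_rpow (s := p - 1) (p := 1) (b := a) (by linarith) (by norm_num) ha
  simpa using this

lemma intA {p a s : ℝ} (hp : 0 < p) (ha : 0 < a) (hs : 0 ≤ s) :
    IntegrableOn (fun x : ℝ => x ^ (p - 1) * Real.exp (-s / x - a * x)) (Ioi 0) := by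
  refine Integrable.mono' (int0 hp ha) (Gi_meas p a s).aestronglyMeasurable ?_
  filter_upwards [ae_restrict_mem measurableSet_Ioi] with x hx
  have hx : 0 < x := hx
  rw [Real.norm_of_nonneg (by positivity)]
  gcongr
  have : 0 ≤ s / x := by positivity
  rw [neg_div]; linarith

lemma intB {p a s : ℝ} (ha : 0 < a) (hs : 0 < s) :
    IntegrableOn (fun x : ℝ => x ^ (p - 1) * Real.exp (-s / x - a * x)) (Ioi 0) := by
  obtain ⟨n, hn⟩ := exists_nat_gt (-p)
  refine Integrable.mono' ((int0 (p := p + n) (by linarith) ha).const_mul (n.factorial / s ^ n)) (Gi_meas p a s).aestronglyMeasurable ?_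
  filter_upwards [ae_restrict_mem measurableSet_Ioi] with x hx
  have hx : 0 < x := hx
  rw [Real.norm_of_nonneg (by positivity)]
  have h1 : Real.exp (-s / x) ≤ n.factorial / s ^ n * x ^ n := by
    have := Real.pow_div_factorial_le_exp (s / x) (by positivity) n
    rw [neg_div, Real.exp_neg, inv_le_comm₀ (by positivity) (by positivity)]
    refine le_trans (le_of_eq ?_) this
    rw [div_pow]
    field_simp
  have h2 : x ^ (p + n - 1) = x ^ (p - 1) * x ^ n := by
    rw [← Real.rpow_natCast x n, ← Real.rpow_add hx]; ring_nf
  rw [h2, sub_eq_add_neg (-s / x), Real.exp_add]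
  calc _ ≤ x ^ (p - 1) * ((n.factorial / s ^ n * x ^ n) * Real.exp (-(a * x))) := by gcongr
    _ = _ := by rw [neg_mul]; ring

lemma intC {p s : ℝ} (hp : p < 0) (hs : 0 < s) :
    IntegrableOn (fun x : ℝ => x ^ (p - 1) * Real.exp (-s / x - 0 * x)) (Ioi 0) := by
  rw [← Ioc_union_Ioi_eq_Ioi (zero_le_one (α := ℝ))]
  refine IntegrableOn.union ?_ ?_
  · have := ((intB (p := p) (one_pos) hs).mono_set (t := Ioi 0) (s := Ioc 0 1) (fun x hx => hx.1)).const_mul (Real.exp 1)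
    refine Integrable.mono' this (Gi_meas p 0 s).aestronglyMeasurable ?_
    filter_upwards [ae_restrict_mem measurableSet_Ioc] with x hx
    have hx0 : 0 < x := hx.1
    rw [Real.norm_of_nonneg (by positivity), mul_left_comm, ← Real.exp_add]
    gcongr
    linarith [hx.2]
  · have := integrableOn_Ioi_rpow_of_lt (a := p - 1) (by linarith) (one_pos)
    refine Integrable.mono' this (Gi_meas p 0 s).aestronglyMeasurable ?_
    filter_upwards [ae_restrict_mem measurableSet_Ioi] with x hx
    have hx0 : 0 < x := one_pos.trans hx
    rw [Real.norm_of_nonneg (by positivity)]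
    refine mul_le_of_le_one_right (by positivity) ?_
    rw [Real.exp_le_one_iff, neg_div]
    have : 0 < s / x := by positivity
    linarith

lemma Gi_pos {p a s : ℝ} (h : IntegrableOn (fun x : ℝ => x ^ (p - 1) * Real.exp (-s / x - a * x)) (Ioi 0)) :
    0 < Gi p a s := by
  unfold Gi
  rw [setIntegral_pos_iff_support_of_nonneg_ae _ h]
  · have : Function.support (fun x : ℝ => x ^ (p - 1) * Real.exp (-s / x - a * x)) ∩ Ioi 0 = Ioi 0 := by
      rw [inter_eq_right]
      intro x hx
      have hx : 0 < x := hx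
      simp only [Function.mem_support]
      positivity
    rw [this]; simp
  · filter_upwards [ae_restrict_mem measurableSet_Ioi] with x hx
    have hx : 0 < x := hx
    simp only [Pi.zero_apply]
    positivity

lemma f_eq (lam χ ψ μ β y : ℝ) (h : IntegrableOn (fun x : ℝ => x ^ (lam - 1/2 - 1) * 
    Real.exp (-(((y-μ)^2+χ)/2) / x - (β^2+ψ)/2 * x)) (Ioi 0)) :
    ∫⁻ x in Ioi (0:ℝ), ENNReal.ofReal
      ((2 * π * x) ^ (-(1:ℝ)/2) * Real.exp (-(y - μ - β * x) ^ 2 / (2 * x)) *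
        (x ^ (lam - 1) * Real.exp (-(χ / x + ψ * x) / 2))) = 
    ENNReal.ofReal ((2 * π) ^ (-(1:ℝ)/2) * Real.exp (β * (y - μ)) * 
      Gi (lam - 1/2) ((β^2+ψ)/2) (((y-μ)^2+χ)/2)) := by
  unfold Gi
  rw [← integral_const_mul, ofReal_integral_eq_lintegral_ofReal]
  · refine setLIntegral_congr_fun measurableSet_Ioi fun x hx => ?_
    have hx : 0 < x := hx
    congr 1
    rw [Real.mul_rpow (by positivity) hx.le]
    have h1 : x ^ (lam - 1/2 - 1) = x ^ (-(1:ℝ)/2) * x ^ (lam - 1) := by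
      rw [← Real.rpow_add hx]; ring_nf
    have h2 : Real.exp (-(y - μ - β * x) ^ 2 / (2 * x)) * Real.exp (-(χ / x + ψ * x) / 2) = 
      Real.exp (β * (y - μ)) * Real.exp (-(((y-μ)^2+χ)/2) / x - (β^2+ψ)/2 * x) := by
      rw [← Real.exp_add, ← Real.exp_add]
      congr 1
      field_simp
      ring
    rw [h1]
    linear_combination ((2 * π) ^ (-(1:ℝ)/2) * x ^ (-(1:ℝ)/2) * x ^ (lam - 1)) * h2
  · exact h.const_mul _
  · filter_upwards [ae_restrict_mem measurableSet_Ioi] with x hx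
    have hx : 0 < x := hx
    simp only [Pi.zero_apply]
    positivity

noncomputable def Kf (p z : ℝ) : ℝ := ∫ u : ℝ, Real.exp (p * u - z * Real.cosh u)

lemma img (c : ℝ) (hc : 0 < c) : (fun u : ℝ => c * Real.exp u) '' univ = Ioi 0 := by
  ext x
  simp only [image_univ, mem_range, mem_Ioi]
  constructor
  · rintro ⟨u, rfl⟩; positivity
  · intro hx
    refine ⟨Real.log (x / c), ?_⟩
    rw [Real.exp_log (by positivity)]; field_simp

lemma pointw {p b r : ℝ} (hb : 0 < b) (hr : 0 < r) (u : ℝ) :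
    |r / b * Real.exp u| • ((r / b * Real.exp u) ^ (p - 1) *
      Real.exp (-(r^2/2) / (r / b * Real.exp u) - b^2/2 * (r / b * Real.exp u)))
     = (r / b) ^ p * Real.exp (p * u - (b * r) * Real.cosh u) := by
  have h0 : 0 < r / b * Real.exp u := by positivity
  have h1 : -(r^2/2) / (r / b * Real.exp u) - b^2/2 * (r / b * Real.exp u) = - (b * r) * Real.cosh u := by
    rw [Real.cosh_eq, Real.exp_neg]; field_simp; ring
  have h2 : (r / b * Real.exp u) * (r / b * Real.exp u) ^ (p - 1) = (r/b)^p * Real.exp (p * u) := by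
    rw [Real.rpow_sub_one h0.ne', mul_div_cancel₀ _ h0.ne', Real.mul_rpow (by positivity) (by positivity),
      ← Real.exp_mul, mul_comm u]
  rw [abs_of_pos h0, smul_eq_mul, ← mul_assoc, h2, h1, mul_assoc, ← Real.exp_add]
  ring_nf

lemma hder (c u : ℝ) : HasDerivWithinAt (fun u : ℝ => c * Real.exp u) (c * Real.exp u) univ u :=
  ((Real.hasDerivAt_exp u).const_mul c).hasDerivWithinAt

lemma hinj (c : ℝ) (hc : 0 < c) : InjOn (fun u : ℝ => c * Real.exp u) univ := by
  intro u _ v _ h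
  exact Real.exp_injective (mul_left_cancel₀ hc.ne' h)

lemma Gi_eq_Kf {p b r : ℝ} (hb : 0 < b) (hr : 0 < r) :
    Gi p (b^2/2) (r^2/2) = (r/b)^p * Kf p (b * r) := by
  have hc : 0 < r / b := by positivity
  unfold Gi Kf
  rw [← img (r/b) hc, integral_image_eq_integral_abs_deriv_smul MeasurableSet.univ
    (fun u _ => hder (r/b) u) (hinj _ hc), ← integral_const_mul, setIntegral_univ]
  congr 1
  ext u
  exact pointw hb hr u

lemma Kf_int {p z : ℝ} (hz : 0 < z) : Integrable (fun u : ℝ => Real.exp (p * u - z * Real.cosh u)) := by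
  have h := intB (p := p) (a := 1^2/2) (s := z^2/2) (by norm_num) (by positivity)
  have hc : 0 < z / 1 := by positivity
  rw [← img (z/1) hc, integrableOn_image_iff_integrableOn_abs_deriv_smul MeasurableSet.univ
    (fun u _ => hder (z/1) u) (hinj _ hc), integrableOn_univ] at h
  have h2 := h.const_mul (((z / 1) ^ p)⁻¹)
  refine h2.congr (Filter.Eventually.of_forall fun u => ?_)
  have := pointw (p := p) one_pos hz u
  simp only at this ⊢
  rw [this, one_mul, inv_mul_cancel_left₀ (by positivity)]

lemma Kf_pos {p z : ℝ} (hz : 0 < z) : 0 < Kf p z := integral_exp_pos (Kf_int hz)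

lemma cosh_ge (u : ℝ) : 1 + u^2/2 ≤ Real.cosh u := by
  have h : Real.cosh u = 1 + 2 * Real.sinh (u/2)^2 := by
    have := Real.cosh_two_mul (u/2)
    rw [Real.cosh_sq, show 2 * (u/2) = u by ring] at this
    linarith
  have h2 : (u/2)^2 ≤ Real.sinh (u/2)^2 := by
    rw [sq_le_sq, Real.abs_sinh]
    exact Real.self_le_sinh_iff.2 (abs_nonneg _)
  rw [h]; linarith

lemma Kf_upper (p : ℝ) : ∃ C, ∀ z ≥ 1, Real.log (Kf p z) ≤ -z - 1/2 * Real.log z + C := by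
  refine ⟨p^2/2 + 1/2 * Real.log (2*π), fun z hz => ?_⟩
  have hz0 : 0 < z := by linarith
  have h1 : Kf p z ≤ ∫ u : ℝ, Real.exp (-z + p^2/2) * Real.exp (-(z/2) * (u - p/z)^2) := by
    refine integral_mono (Kf_int hz0) ?_ fun u => ?_
    · exact ((integrable_exp_neg_mul_sq (b := z/2) (by positivity)).comp_sub_right (p/z)).const_mul _
    · simp only
      rw [← Real.exp_add]
      gcongr
      have h2 : z * (1 + u^2/2) ≤ z * Real.cosh u := by gcongr; exact cosh_ge u
      have h3 : -(z/2) * (u - p/z)^2 = -(z/2)*u^2 + p * u - p^2/(2*z) := by field_simp; ring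
      have h4 : p^2/(2*z) ≤ p^2/2 := by
        gcongr; linarith
      rw [h3]; linarith
  rw [integral_const_mul, integral_sub_right_eq_self (fun u => Real.exp (-(z/2) * u^2)), integral_gaussian] at h1
  have h5 := Real.log_le_log (Kf_pos hz0) h1
  rw [Real.log_mul (by positivity) (by positivity), Real.log_exp, Real.log_sqrt (by positivity),
    show π / (z/2) = (2*π) / z by field_simp, Real.log_div (by positivity) (by positivity)] at h5
  linarith

lemma Kf_lower (p : ℝ) : ∃ C, ∀ z ≥ 1, -z - 1/2 * Real.log z - C ≤ Real.log (Kf p z) := by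
  refine ⟨|p| + 1, fun z hz => ?_⟩
  have hz0 : 0 < z := by linarith
  have hsq : 1 ≤ √z := by rw [Real.one_le_sqrt]; exact hz
  have h1 : (1/√z) * Real.exp (-z - (|p| + 1)) ≤ Kf p z := by
    calc _ = ∫ u in Icc 0 (1/√z), Real.exp (-z - (|p| + 1)) := by
          rw [setIntegral_const, Real.volume_real_Icc_of_le (by positivity)]; simp
      _ ≤ ∫ u in Icc 0 (1/√z), Real.exp (p * u - z * Real.cosh u) := by
          refine setIntegral_mono_on (by simp) (Kf_int hz0).integrableOn measurableSet_Icc fun u hu => ?_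
          apply Real.exp_le_exp.2
          have hu1 : u ≤ 1 := hu.2.trans (by rw [div_le_one (by linarith)]; exact hsq)
          have hpu : -|p| ≤ p * u := by
            have : |p * u| ≤ |p| := by
              rw [abs_mul, abs_of_nonneg hu.1]
              exact mul_le_of_le_one_right (abs_nonneg _) hu1
            exact (neg_le_neg this).trans (neg_abs_le _)
          have hu2 : z * u^2 ≤ 1 := by
            have h2 := hu.2
            rw [le_div_iff₀ (by linarith)] at h2
            have h3 : (u * √z)^2 ≤ 1 := pow_le_one₀ (mul_nonneg hu.1 (by positivity)) h2
            rw [mul_pow, Real.sq_sqrt hz0.le] at h3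
            linarith
          have hc : Real.cosh u ≤ 1 + u^2 := by
            refine (Real.cosh_le_exp_half_sq u).trans ?_
            have hq : u^2 ≤ 1 := pow_le_one₀ hu.1 hu1
            have h4 : 1 - u^2/2 ≤ Real.exp (-(u^2/2)) := by
              have := Real.add_one_le_exp (-(u^2/2)); linarith
            rw [Real.exp_neg, le_inv_comm₀ (by linarith) (by positivity)] at h4
            refine h4.trans ?_
            rw [inv_le_iff_one_le_mul₀ (by linarith)]
            nlinarith [sq_nonneg u]
          nlinarith
      _ ≤ Kf p z := setIntegral_le_integral (Kf_int hz0) (Filter.Eventually.of_forall fun u => by simp only [Pi.zero_apply]; positivity)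
  have h5 := Real.log_le_log (by positivity) h1
  rw [Real.log_mul (by positivity) (by positivity), Real.log_exp, one_div, Real.log_inv, Real.log_sqrt (by positivity)] at h5
  linarith

lemma Kf_eq_cosh {p z : ℝ} (hz : 0 < z) :
    Integrable (fun u => Real.cosh (p * u) * Real.exp (-z * Real.cosh u)) ∧
    Kf p z = ∫ u, Real.cosh (p * u) * Real.exp (-z * Real.cosh u) := by
  have h1 := Kf_int (p := p) hz
  have h2 := Kf_int (p := -p) hz
  have h3 : (fun u => Real.cosh (p * u) * Real.exp (-z * Real.cosh u)) =
     fun u => (1/2) * (Real.exp (p * u - z * Real.cosh u) + Real.exp (-p * u - z * Real.cosh u)) := by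
    ext u
    rw [Real.cosh_eq (p * u), sub_eq_add_neg, sub_eq_add_neg, Real.exp_add, Real.exp_add]
    ring_nf
  have h4 : Kf (-p) z = Kf p z := by
    unfold Kf
    rw [← integral_neg_eq_self]
    simp
  rw [h3]
  refine ⟨(h1.add h2).const_mul _, ?_⟩
  rw [integral_const_mul, integral_add h1 h2]
  change _ = 1/2 * (Kf p z + Kf (-p) z)
  rw [h4]; ring

lemma cosh_ratio {p u v : ℝ} (hp : 1/2 ≤ p) (h : |u| ≤ |v|) :
    Real.cosh ((p-1) * v) * Real.cosh (p * u) ≤ Real.cosh ((p-1) * u) * Real.cosh (p * v) := by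
  wlog hu : 0 ≤ u generalizing u
  · have := this (u := -u) (by simpa using h) (by linarith)
    simpa using this
  wlog hv : 0 ≤ v generalizing v
  · have := this (v := -v) (by simpa using h) (by linarith)
    simpa using this
  rw [abs_of_nonneg hu, abs_of_nonneg hv] at h
  have e : ∀ a b : ℝ, Real.cosh a * Real.cosh b = (Real.cosh (a + b) + Real.cosh (b - a)) / 2 := by
    intro a b; rw [Real.cosh_add, Real.cosh_sub]; ring
  rw [e, e]
  have h1 : Real.cosh ((p-1) * v + p * u) ≤ Real.cosh ((p-1) * u + p * v) := by
    rw [Real.cosh_le_cosh]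
    apply abs_le_abs <;> nlinarith
  have h2 : Real.cosh (p * u - (p-1) * v) ≤ Real.cosh (p * v - (p-1) * u) := by
    rw [Real.cosh_le_cosh]
    apply abs_le_abs <;> nlinarith
  linarith

lemma Kf_cheb {p z w : ℝ} (hp : 1/2 ≤ p) (hz : 0 < z) (hzw : z ≤ w) :
    Kf (p-1) z * Kf p w ≤ Kf (p-1) w * Kf p z := by
  have hw : 0 < w := by linarith
  obtain ⟨i1, e1⟩ := Kf_eq_cosh (p := p-1) hz
  obtain ⟨i2, e2⟩ := Kf_eq_cosh (p := p) hw
  obtain ⟨i3, e3⟩ := Kf_eq_cosh (p := p-1) hw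
  obtain ⟨i4, e4⟩ := Kf_eq_cosh (p := p) hz
  have H : 0 ≤ ∫ x : ℝ × ℝ, (
      (Real.cosh ((p-1) * x.1) * Real.exp (-w * Real.cosh x.1)) * (Real.cosh (p * x.2) * Real.exp (-z * Real.cosh x.2))
      + (Real.cosh (p * x.1) * Real.exp (-z * Real.cosh x.1)) * (Real.cosh ((p-1) * x.2) * Real.exp (-w * Real.cosh x.2))
      - ((Real.cosh ((p-1) * x.1) * Real.exp (-z * Real.cosh x.1)) * (Real.cosh (p * x.2) * Real.exp (-w * Real.cosh x.2))
      + (Real.cosh (p * x.1) * Real.exp (-w * Real.cosh x.1)) * (Real.cosh ((p-1) * x.2) * Real.exp (-z * Real.cosh x.2)))) := by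
    refine integral_nonneg fun ⟨u, v⟩ => ?_
    simp only [Pi.zero_apply]
    have key : 0 ≤ (Real.cosh ((p-1) * u) * Real.cosh (p * v) - Real.cosh ((p-1) * v) * Real.cosh (p * u)) *
       (Real.exp (-w * Real.cosh u) * Real.exp (-z * Real.cosh v) - Real.exp (-z * Real.cosh u) * Real.exp (-w * Real.cosh v)) := by
      rw [← Real.exp_add, ← Real.exp_add]
      rcases le_total |u| |v| with h | h
      · refine mul_nonneg (sub_nonneg.2 (cosh_ratio hp h)) (sub_nonneg.2 ?_)
        have := Real.cosh_le_cosh.2 h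
        apply Real.exp_le_exp.2
        nlinarith
      · refine mul_nonneg_of_nonpos_of_nonpos (sub_nonpos.2 (cosh_ratio hp h)) (sub_nonpos.2 ?_)
        have := Real.cosh_le_cosh.2 h
        apply Real.exp_le_exp.2
        nlinarith
    linarith
  rw [Measure.volume_eq_prod] at H
  replace H := H.trans_eq (integral_sub ((i3.mul_prod i4).add (i4.mul_prod i3)) ((i1.mul_prod i2).add (i2.mul_prod i1)))
  replace H := H.trans_eq (congrArg₂ (· - ·) (integral_add (i3.mul_prod i4) (i4.mul_prod i3)) (integral_add (i1.mul_prod i2) (i2.mul_prod i1)))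
  rw [integral_prod_mul (fun u => Real.cosh ((p-1) * u) * Real.exp (-w * Real.cosh u)) (fun u => Real.cosh (p * u) * Real.exp (-z * Real.cosh u)),
    integral_prod_mul (fun u => Real.cosh (p * u) * Real.exp (-z * Real.cosh u)) (fun u => Real.cosh ((p-1) * u) * Real.exp (-w * Real.cosh u)),
    integral_prod_mul (fun u => Real.cosh ((p-1) * u) * Real.exp (-z * Real.cosh u)) (fun u => Real.cosh (p * u) * Real.exp (-w * Real.cosh u)),
    integral_prod_mul (fun u => Real.cosh (p * u) * Real.exp (-w * Real.cosh u)) (fun u => Real.cosh ((p-1) * u) * Real.exp (-z * Real.cosh u)),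
    ← e1, ← e2, ← e3, ← e4] at H
  linarith

lemma Gi_deriv {p a s : ℝ} (ha : 0 < a) (hs : 0 < s) :
    HasDerivAt (fun s => Gi p a s) (-Gi (p - 1) a s) s := by
  have h := hasDerivAt_integral_of_dominated_loc_of_deriv_le (μ := volume.restrict (Ioi (0:ℝ)))
    (F := fun (s x : ℝ) => x ^ (p - 1) * Real.exp (-s / x - a * x))
    (F' := fun (s x : ℝ) => -(x ^ (p - 1 - 1) * Real.exp (-s / x - a * x)))
    (bound := fun x => x ^ (p - 1 - 1) * Real.exp (-(s/2) / x - a * x))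
    (x₀ := s) (s := Ioi (s/2)) (Ioi_mem_nhds (by linarith))
    (Filter.Eventually.of_forall fun t => (Gi_meas p a t).aestronglyMeasurable)
    (intB ha hs) (Gi_meas (p-1) a s).neg.aestronglyMeasurable ?_ (intB ha (by linarith)) ?_
  · have h2 := h.2
    rw [integral_neg] at h2
    exact h2
  · filter_upwards [ae_restrict_mem measurableSet_Ioi] with x hx t ht
    have hx : 0 < x := hx
    have ht : s/2 < t := ht
    rw [norm_neg, Real.norm_of_nonneg (by positivity)]
    gcongr
  · filter_upwards [ae_restrict_mem measurableSet_Ioi] with x hx t ht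
    have hx : 0 < x := hx
    have h1 : HasDerivAt (fun t : ℝ => -t / x - a * x) (-1 / x) t :=
      (((hasDerivAt_id t).neg).div_const x).sub_const _
    refine (h1.exp.const_mul (x ^ (p - 1))).congr_deriv ?_
    rw [Real.rpow_sub_one hx.ne' (p - 1)]
    field_simp

lemma M_cont {p a : ℝ} (hp : 0 < p) (ha : 0 < a) : Continuous (fun r : ℝ => Gi p a (r^2/2)) := by
  refine continuous_of_dominated (bound := fun x => x ^ (p - 1) * Real.exp (- a * x)) 
    (fun r => (Gi_meas p a _).aestronglyMeasurable) ?_ (int0 hp ha) ?_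
  · intro r
    filter_upwards [ae_restrict_mem measurableSet_Ioi] with x hx
    have hx : 0 < x := hx
    rw [Real.norm_of_nonneg (by positivity)]
    gcongr
    have : 0 ≤ (r^2/2) / x := by positivity
    rw [neg_div]; linarith
  · exact Filter.Eventually.of_forall fun x => by fun_prop

lemma M_concave {p b : ℝ} (hp : 1/2 ≤ p) (hb : 0 < b) :
    ConcaveOn ℝ (Ici 0) (fun r : ℝ => Real.log (Gi p (b^2/2) (r^2/2))) := by
  have ha : 0 < b^2/2 := by positivity
  have hp0 : 0 < p := by linarith
  have hpos : ∀ r : ℝ, 0 < Gi p (b^2/2) (r^2/2) := fun r => Gi_pos (intA hp0 ha (by positivity))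
  have hd : ∀ r : ℝ, 0 < r → HasDerivAt (fun r : ℝ => Real.log (Gi p (b^2/2) (r^2/2)))
      (-b * (Kf (p-1) (b * r) / Kf p (b * r))) r := by
    intro r hr
    have h1 : HasDerivAt (fun r : ℝ => r^2/2) r r := by
      have := (hasDerivAt_pow 2 r).div_const 2
      simpa using this
    have h3 : HasDerivAt (fun r : ℝ => Gi p (b^2/2) (r^2/2)) (-Gi (p - 1) (b^2/2) (r^2/2) * r) r :=
      HasDerivAt.comp (h₂ := fun s => Gi p (b^2/2) s) (h := fun r : ℝ => r^2/2) r
        (Gi_deriv (p := p) ha (s := r^2/2) (by positivity)) h1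
    have h2 := h3.log (hpos r).ne'
    refine h2.congr_deriv ?_
    have hK := Kf_pos (p := p) (z := b * r) (by positivity)
    rw [Gi_eq_Kf hb hr, Gi_eq_Kf hb hr, Real.rpow_sub_one (by positivity)]
    have : 0 < (r/b)^p := by positivity
    field_simp
  refine AntitoneOn.concaveOn_of_deriv (convex_Ici 0) ?_ ?_ ?_
  · exact ((M_cont hp0 ha).log fun r => (hpos r).ne').continuousOn
  · rw [interior_Ici]
    exact fun r hr => (hd r hr).differentiableAt.differentiableWithinAt
  · rw [interior_Ici]
    intro r hr t ht hrt
    have hr : 0 < r := hr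
    have ht : 0 < t := ht
    rw [(hd r hr).deriv, (hd t ht).deriv, neg_mul, neg_mul, neg_le_neg_iff]
    refine mul_le_mul_of_nonneg_left ?_ hb.le
    rw [div_le_div_iff₀ (Kf_pos (by positivity)) (Kf_pos (by positivity))]
    exact Kf_cheb hp (by positivity) (by gcongr)

lemma Gi_anti {p a s t : ℝ} (hp : 0 < p) (ha : 0 < a) (hs : 0 ≤ s) (hst : s ≤ t) :
    Gi p a t ≤ Gi p a s := by
  refine setIntegral_mono_on (intA hp ha (hs.trans hst)) (intA hp ha hs) measurableSet_Ioi fun x hx => ?_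
  have hx : 0 < x := hx
  gcongr

lemma sqrt_convex {χ : ℝ} (hχ : 0 ≤ χ) (x y θ : ℝ) (h0 : 0 < θ) (h1 : θ < 1) :
    (θ * x + (1 - θ) * y)^2 + χ ≤ (θ * √(x^2+χ) + (1-θ) * √(y^2+χ))^2 := by
  have hx := Real.sq_sqrt (show 0 ≤ x^2+χ by positivity)
  have hy := Real.sq_sqrt (show 0 ≤ y^2+χ by positivity)
  have h : x * y + χ ≤ √(x^2+χ) * √(y^2+χ) := by
    rw [← Real.sqrt_mul (by positivity)]
    apply Real.le_sqrt_of_sq_le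
    nlinarith [mul_nonneg hχ (sq_nonneg (x - y))]
  have : 0 < θ * (1 - θ) := mul_pos h0 (by linarith)
  nlinarith

lemma scale {p r : ℝ} (hr : 0 < r) : Gi p 0 (r^2/2) = (r^2)^p * Gi p 0 (1/2) := by
  unfold Gi
  have h := integral_comp_mul_left_Ioi (fun x : ℝ => x ^ (p - 1) * Real.exp (-(r^2/2) / x - 0 * x)) 0 (b := r^2) (by positivity)
  rw [mul_zero] at h
  have h2 : (r^2)^(p-1) * ∫ x in Ioi (0:ℝ), x ^ (p - 1) * Real.exp (-(1/2) / x - 0 * x) = 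
     ∫ x in Ioi (0:ℝ), (r^2 * x) ^ (p - 1) * Real.exp (-(r^2/2) / (r^2*x) - 0 * (r^2*x)) := by
    rw [← integral_const_mul]
    refine setIntegral_congr_fun measurableSet_Ioi fun x hx => ?_
    have hx : 0 < x := hx
    rw [Real.mul_rpow (by positivity) hx.le, mul_assoc, 
      show -(r^2/2) / (r^2*x) - 0 * (r^2*x) = -(1/2) / x - 0 * x by field_simp; ring]
  rw [← h2, Real.rpow_sub_one (by positivity), smul_eq_mul] at h
  generalize (∫ x in Ioi (0:ℝ), x ^ (p - 1) * Real.exp (-(1/2) / x - 0 * x)) = A at h ⊢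
  generalize (∫ x in Ioi (0:ℝ), x ^ (p - 1) * Real.exp (-(r^2/2) / x - 0 * x)) = B at h ⊢
  field_simp at h ⊢
  linarith

theorem generalized_hyperbolic_logConcave_iff
    (lam χ ψ μ β : ℝ)
    (hlam_pos : 0 < lam → 0 ≤ χ ∧ 0 < ψ)
    (hlam_zero : lam = 0 → 0 < χ ∧ 0 < ψ)
    (hlam_neg : lam < 0 → 0 < χ ∧ 0 ≤ ψ)
    (hconv : 0 < β ^ 2 + ψ ∨ lam < 1/2)
    (f : ℝ → ℝ≥0∞)
    (hf : ∀ y, f y = ∫⁻ x in Ioi (0:ℝ), ENNReal.ofReal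
      ((2 * π * x) ^ (-(1:ℝ)/2) * Real.exp (-(y - μ - β * x) ^ 2 / (2 * x)) *
        (x ^ (lam - 1) * Real.exp (-(χ / x + ψ * x) / 2)))) :
    (∀ y₁ y₂ : ℝ, ∀ θ ∈ Ioo (0:ℝ) 1,
        f y₁ ^ θ * f y₂ ^ (1 - θ) ≤ f (θ * y₁ + (1 - θ) * y₂)) ↔ 1 ≤ lam := by
  have hpi : 0 < (2 * π) ^ (-(1:ℝ)/2) := by positivity
  have hχ0 : 0 ≤ χ := by
    rcases lt_trichotomy lam 0 with h | h | h
    · exact (hlam_neg h).1.le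
    · exact (hlam_zero h).1.le
    · exact (hlam_pos h).1
  have hψ0 : 0 ≤ ψ := by
    rcases lt_trichotomy lam 0 with h | h | h
    · exact (hlam_neg h).2
    · exact (hlam_zero h).2.le
    · exact (hlam_pos h).2.le
  have hlog : ∀ t G : ℝ, 0 < G → Real.log ((2 * π) ^ (-(1:ℝ)/2) * Real.exp (β * t) * G) = 
      Real.log ((2 * π) ^ (-(1:ℝ)/2)) + β * t + Real.log G := by
    intro t G hG
    rw [Real.log_mul (by positivity) hG.ne', Real.log_mul (by positivity) (by positivity), Real.log_exp]
  set b := √(β^2 + ψ) with hbdef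
  have hb2 : b^2 = β^2 + ψ := Real.sq_sqrt (by positivity)
  have hab : (β^2+ψ)/2 = b^2/2 := by rw [hb2]
  set p := lam - 1/2 with hp
  constructor
  · intro H
    by_contra hl
    push Not at hl
    -- integrability
    have hint : ∀ t : ℝ, 0 < t → IntegrableOn (fun x : ℝ => x ^ (p - 1) * 
        Real.exp (-((t^2+χ)/2) / x - (β^2+ψ)/2 * x)) (Ioi 0) := by
      intro t ht
      rcases (show 0 ≤ β^2 + ψ by positivity).eq_or_lt with h | h
      · have hlt : lam < 1/2 := by
          rcases hconv with h' | h'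
          · linarith
          · exact h'
        rw [← h, zero_div]
        exact intC (by linarith) (by positivity)
      · exact intB (by positivity) (by positivity)
    have hFp : ∀ t : ℝ, 0 < t → 0 < Gi p ((β^2+ψ)/2) ((t^2+χ)/2) := fun t ht => Gi_pos (hint t ht)
    have hconc : ∀ T : ℝ, 1 ≤ T → ConcaveOn ℝ (Ici T) (fun t => Real.log (Gi p ((β^2+ψ)/2) ((t^2+χ)/2))) := by
      intro T hT
      refine ⟨convex_Ici T, fun x hx y hy θ θ' h0 h0' hθ => ?_⟩
      have hx : T ≤ x := hx
      have hy : T ≤ y := hy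
      obtain rfl : θ' = 1 - θ := by linarith
      simp only [smul_eq_mul]
      rcases h0.eq_or_lt with rfl | h0
      · simp
      rcases h0'.eq_or_lt with h1 | h1
      · obtain rfl : θ = 1 := by linarith
        simp
      have hm : 0 < θ * x + (1 - θ) * y := by
        have := mul_pos h0 (show 0 < x by linarith)
        have := mul_pos h1 (show 0 < y by linarith)
        linarith
      have h := H (x + μ) (y + μ) θ ⟨h0, by linarith⟩
      have e : θ * (x + μ) + (1 - θ) * (y + μ) - μ = θ * x + (1 - θ) * y := by ring
      have ex : x + μ - μ = x := by ring
      have ey : y + μ - μ = y := by ring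
      rw [hf, hf, hf, f_eq, f_eq, f_eq, e, ex, ey] at h
      · have gx := hFp x (by linarith)
        have gy := hFp y (by linarith)
        have gm := hFp _ hm
        rw [lc_iff (by positivity) (by positivity) (by positivity), hlog _ _ gx, hlog _ _ gy, hlog _ _ gm] at h
        linarith
      · rw [e]; exact hint _ hm
      · rw [ey]; exact hint _ (by linarith)
      · rw [ex]; exact hint _ (by linarith)
    -- r
    have hr : ∀ t : ℝ, 1 ≤ t → t ≤ √(t^2+χ) ∧ √(t^2+χ) ≤ t + √χ ∧ (t^2+χ)/2 = √(t^2+χ)^2/2 ∧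
        Real.log t ≤ Real.log √(t^2+χ) ∧ Real.log √(t^2+χ) ≤ Real.log t + Real.log (1 + √χ) := by
      intro t ht
      have h1 : t ≤ √(t^2+χ) := Real.le_sqrt_of_sq_le (by linarith)
      have h2 : √(t^2+χ) ≤ t + √χ := by
        rw [Real.sqrt_le_left (by positivity)]
        have := Real.sq_sqrt hχ0
        have : 0 ≤ t * √χ := by positivity
        nlinarith
      refine ⟨h1, h2, ?_, Real.log_le_log (by linarith) h1, ?_⟩
      · rw [Real.sq_sqrt (by positivity)]
      · rw [← Real.log_mul (by linarith) (by positivity)]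
        apply Real.log_le_log (by linarith)
        refine h2.trans ?_
        nlinarith [Real.sqrt_nonneg χ]
    rcases (show 0 ≤ β^2 + ψ by positivity).eq_or_lt with h | h
    · -- degenerate
      have hlt : lam < 1/2 := by
        rcases hconv with h' | h'
        · linarith
        · exact h'
      have hp0 : p < 0 := by linarith
      have hG : 0 < Gi p 0 (1/2) := Gi_pos (intC hp0 (by norm_num))
      have hform : ∀ t ≥ (1:ℝ), Real.log (Gi p ((β^2+ψ)/2) ((t^2+χ)/2)) = 
          p * (2 * Real.log √(t^2+χ)) + Real.log (Gi p 0 (1/2)) := by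
        intro t ht
        obtain ⟨h1, h2, h3, h4, h5⟩ := hr t ht
        have : 0 < √(t^2+χ) := by linarith
        rw [h3, ← h, zero_div, scale this, Real.log_mul (by positivity) hG.ne', Real.log_rpow (by positivity),
          Real.log_pow]
        norm_num
      refine contra_lemma _ 0 1 (Real.log (Gi p 0 (1/2))) (-2*p) (-Real.log (Gi p 0 (1/2)) - 2 * p * Real.log (1 + √χ)) (-2*p) le_rfl (by linarith) (hconc 1 le_rfl) ?_ ?_
      · intro t ht
        obtain ⟨h1, h2, h3, h4, h5⟩ := hr t ht
        simp only [hform t ht]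
        nlinarith
      · intro t ht
        obtain ⟨h1, h2, h3, h4, h5⟩ := hr t ht
        simp only [hform t ht]
        nlinarith
    · have hb : 0 < b := Real.sqrt_pos.2 h
      obtain ⟨C1, hC1⟩ := Kf_upper p
      obtain ⟨C2, hC2⟩ := Kf_lower p
      have hform : ∀ t ≥ (1:ℝ), Real.log (Gi p ((β^2+ψ)/2) ((t^2+χ)/2)) = 
          p * (Real.log √(t^2+χ) - Real.log b) + Real.log (Kf p (b * √(t^2+χ))) := by
        intro t ht
        obtain ⟨h1, h2, h3, h4, h5⟩ := hr t ht
        have hr0 : 0 < √(t^2+χ) := by linarith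
        have hK := Kf_pos (p := p) (mul_pos hb hr0)
        rw [h3, hab, Gi_eq_Kf hb hr0, Real.log_mul (by positivity) hK.ne', Real.log_rpow (by positivity),
          Real.log_div hr0.ne' hb.ne']
      have hT : (1:ℝ) ≤ max 1 (1/b) := le_max_left _ _
      have hz : ∀ t ≥ max 1 (1/b), 1 ≤ b * √(t^2+χ) := by
        intro t ht
        obtain ⟨h1, h2, h3, h4, h5⟩ := hr t (hT.trans ht)
        have : 1 / b ≤ √(t^2+χ) := (le_max_right _ _).trans (ht.trans h1)
        rw [div_le_iff₀ hb] at this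
        linarith
      have hk : 0 < 1/2 - p := by linarith
      refine contra_lemma _ b (max 1 (1/b)) (C1 - p * Real.log b - 1/2 * Real.log b) (1/2 - p)
        (C2 + p * Real.log b + 1/2 * Real.log b + b * √χ + (1/2-p) * Real.log (1 + √χ)) (1/2 - p) hT hk (hconc _ hT) ?_ ?_
      · intro t ht
        have ht1 : 1 ≤ t := hT.trans ht
        obtain ⟨h1, h2, h3, h4, h5⟩ := hr t ht1
        have h6 := hC1 _ (hz t ht)
        rw [Real.log_mul hb.ne' (by linarith)] at h6
        simp only [hform t ht1]
        have h7 := mul_le_mul_of_nonneg_left h4 hk.le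
        have h8 := mul_le_mul_of_nonneg_left h1 hb.le
        linarith
      · intro t ht
        have ht1 : 1 ≤ t := hT.trans ht
        obtain ⟨h1, h2, h3, h4, h5⟩ := hr t ht1
        have h6 := hC2 _ (hz t ht)
        rw [Real.log_mul hb.ne' (by linarith)] at h6
        simp only [hform t ht1]
        have h7 := mul_le_mul_of_nonneg_left h5 hk.le
        have h8 := mul_le_mul_of_nonneg_left h2 hb.le
        linarith
  · intro hl y₁ y₂ θ hθ
    have hψ : 0 < ψ := (hlam_pos (by linarith)).2
    have hb : 0 < b := Real.sqrt_pos.2 (by positivity)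
    have hp2 : 1/2 ≤ p := by linarith
    have hp0 : 0 < p := by linarith
    have ha : 0 < (β^2+ψ)/2 := by positivity
    have hint : ∀ t : ℝ, IntegrableOn (fun x : ℝ => x ^ (p - 1) * 
        Real.exp (-((t^2+χ)/2) / x - (β^2+ψ)/2 * x)) (Ioi 0) := fun t => intA hp0 ha (by positivity)
    have hG : ∀ t : ℝ, 0 < Gi p ((β^2+ψ)/2) ((t^2+χ)/2) := fun t => Gi_pos (hint t)
    have e : θ * y₁ + (1 - θ) * y₂ - μ = θ * (y₁ - μ) + (1 - θ) * (y₂ - μ) := by ring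
    rw [hf, hf, hf, f_eq _ _ _ _ _ _ (hint _), f_eq _ _ _ _ _ _ (hint _), f_eq _ _ _ _ _ _ (hint _), e]
    have g1 := hG (y₁ - μ)
    have g2 := hG (y₂ - μ)
    have g3 := hG (θ * (y₁ - μ) + (1 - θ) * (y₂ - μ))
    rw [lc_iff (by positivity) (by positivity) (by positivity), hlog _ _ g1, hlog _ _ g2, hlog _ _ g3]
    generalize y₁ - μ = x at *
    generalize y₂ - μ = y at *
    have c := (M_concave hp2 hb).2 (x := √(x^2+χ)) (Real.sqrt_nonneg _) (y := √(y^2+χ)) (Real.sqrt_nonneg _)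
      hθ.1.le (show 0 ≤ 1 - θ by linarith [hθ.2]) (by ring)
    simp only [smul_eq_mul] at c
    rw [Real.sq_sqrt (show 0 ≤ x^2+χ by positivity), Real.sq_sqrt (show 0 ≤ y^2+χ by positivity), ← hab] at c
    have d := Gi_anti hp0 ha (s := ((θ * x + (1 - θ) * y)^2 + χ)/2) (t := (θ * √(x^2+χ) + (1-θ) * √(y^2+χ))^2/2)
      (by positivity) (by linarith [sqrt_convex hχ0 x y θ hθ.1 hθ.2])
    have d2 := Real.log_le_log (Gi_pos (intA hp0 ha (by positivity))) d
    linarith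
end

section
/- Let p ≥ 1, let μ, β be vectors in ℝ^p with β ≠ 0, let A be an invertible p×p real matrix, let g be a nonnegative measurable function supported on (0,∞) with 0 < ∫₀^∞ g(x) dx < ∞, and define f(y) = |det A|^{-1} ∫₀^∞ (2πx)^{-p/2} · exp(−‖A⁻¹(y − μ − xβ)‖²/(2x)) · g(x) dx for y ∈ ℝ^p, where ‖·‖ is the Euclidean norm and f is assumed finite everywhere. Then for every t ∈ ℝ and all y₁, y₂ ∈ ℝ^p satisfying ⟨(A Aᵀ)⁻¹ β, yᵢ − μ − tβ⟩ = 0 for i = 1, 2 and ‖A⁻¹(y₁ − μ − tβ)‖ = ‖A⁻¹(y₂ − μ − tβ)‖, one has f(y₁) = f(y₂). -/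
open MeasureTheory Set Real

/-- Proposition 1: a multivariate normal variance-mean mixture density has
ellipsoidal contours on each hyperplane `𝓗_t = μ + βt + {z : zᵀ(AAᵀ)⁻¹β = 0}`:
on `𝓗_t`, the density depends only on `‖A⁻¹(y - μ - tβ)‖`. -/
theorem normal_variance_mean_mixture_ellipsoidal_contours
    (p : ℕ) (hp : 1 ≤ p)
    (μ β : Fin p → ℝ) (hβ : β ≠ 0)
    (A : Matrix (Fin p) (Fin p) ℝ) (hA : IsUnit A.det)
    (g : ℝ → ℝ) (hg_meas : Measurable g) (hg_nonneg : ∀ x, 0 ≤ g x)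
    (hg_supp : ∀ x ≤ 0, g x = 0)
    (hg_int : IntegrableOn g (Ioi 0))
    (hg_pos : 0 < ∫ x in Ioi (0:ℝ), g x)
    (f : (Fin p → ℝ) → ℝ)
    (hf : ∀ y, f y = |A.det|⁻¹ * ∫ x in Ioi (0:ℝ),
      (2 * π * x) ^ (-(p:ℝ)/2) *
        Real.exp (-(∑ i, (A⁻¹.mulVec (y - μ - x • β) i) ^ 2) / (2 * x)) * g x)
    (hf_int : ∀ y, IntegrableOn (fun x =>
      (2 * π * x) ^ (-(p:ℝ)/2) *
        Real.exp (-(∑ i, (A⁻¹.mulVec (y - μ - x • β) i) ^ 2) / (2 * x)) * g x) (Ioi 0)) :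
    ∀ t : ℝ, ∀ y₁ y₂ : Fin p → ℝ,
      (∑ i, ((A * A.transpose)⁻¹.mulVec β) i * (y₁ - μ - t • β) i) = 0 →
      (∑ i, ((A * A.transpose)⁻¹.mulVec β) i * (y₂ - μ - t • β) i) = 0 →
      (∑ i, (A⁻¹.mulVec (y₁ - μ - t • β) i) ^ 2) =
        (∑ i, (A⁻¹.mulVec (y₂ - μ - t • β) i) ^ 2) →
      f y₁ = f y₂ := by
  intro t y₁ y₂ h1 h2 h3
  have key : ∀ y : Fin p → ℝ,
      (∑ i, ((A * A.transpose)⁻¹.mulVec β) i * (y - μ - t • β) i) = 0 → ∀ x : ℝ,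
      (∑ i, (A⁻¹.mulVec (y - μ - x • β) i) ^ 2) =
        (∑ i, (A⁻¹.mulVec (y - μ - t • β) i) ^ 2)
          + (t - x) ^ 2 * ∑ i, (A⁻¹.mulVec β i) ^ 2 := by
    intro y hy x
    have e : y - μ - x • β = (y - μ - t • β) + (t - x) • β := by
      rw [sub_smul]; abel
    have hy' : (∑ i, A⁻¹.mulVec β i * A⁻¹.mulVec (y - μ - t • β) i) = 0 := by
      rw [← hy]
      change dotProduct _ _ = dotProduct _ _
      rw [Matrix.mul_inv_rev, ← Matrix.mulVec_mulVec, ← Matrix.transpose_nonsing_inv,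
        Matrix.mulVec_transpose, Matrix.dotProduct_mulVec]
    rw [e, Matrix.mulVec_add, Matrix.mulVec_smul]
    generalize A⁻¹.mulVec (y - μ - t • β) = w at *
    generalize A⁻¹.mulVec β = b at *
    have : ∀ i, ((w + (t - x) • b) i) ^ 2
        = w i ^ 2 + (t - x) ^ 2 * b i ^ 2 + 2 * (t - x) * (b i * w i) := by
      intro i
      simp only [Pi.add_apply, Pi.smul_apply, smul_eq_mul]
      ring
    simp only [this, Finset.sum_add_distrib, ← Finset.mul_sum, hy']
    ring
  rw [hf, hf]
  have e : ∀ x : ℝ, (∑ i, (A⁻¹.mulVec (y₁ - μ - x • β) i) ^ 2) =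
      (∑ i, (A⁻¹.mulVec (y₂ - μ - x • β) i) ^ 2) := by
    intro x
    rw [key y₁ h1 x, key y₂ h2 x, h3]
  simp only [e]
end

section
/- Let p ≥ 1, let μ, β be vectors in ℝ^p, let A be an invertible p×p real matrix, let g be a nonnegative measurable function supported on (0,∞) with 0 < ∫₀^∞ g(x) dx < ∞, and define f(y) = |det A|^{-1} ∫₀^∞ (2πx)^{-p/2} · exp(−‖A⁻¹(y − μ − xβ)‖²/(2x)) · g(x) dx for y ∈ ℝ^p, assumed finite everywhere. If the function g*(x) = x^{−(p−1)/2} g(x) is unimodal on (0,∞), then every local maximum point of f lies on the line {μ + tβ : t ∈ ℝ}, and f has at most one local maximum point. -/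
open MeasureTheory Set Real

lemma N_left {t1 t2 R α x y : ℝ} (ht : t1 < t2) (hR : 0 < R) (hα : 0 < α) (hx : 0 < x) (hxy : x < y)
    (hy : y ≤ t2) (h : 0 ≤ (y - t2) * exp (-α / y) - R * (y - t1)) :
    0 < (x - t2) * exp (-α / x) - R * (x - t1) := by
  have hE : exp (-α / x) < exp (-α / y) := by
    apply exp_lt_exp.2
    rw [neg_div, neg_div]
    exact neg_lt_neg (div_lt_div_of_pos_left hα hx hxy)
  have hEx := exp_pos (-α / x)
  have hEy := exp_pos (-α / y)
  generalize exp (-α / x) = Ex at *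
  generalize exp (-α / y) = Ey at *
  have hy1 : y < t1 := by
    by_contra hc
    push Not at hc
    have h1 : 0 ≤ R * (y - t1) := by apply mul_nonneg hR.le; linarith
    have h2 : 0 ≤ (t2 - y) * Ey := by apply mul_nonneg _ hEy.le; linarith
    rcases hc.lt_or_eq with h3 | h3
    · have : 0 < R * (y - t1) := by apply mul_pos hR; linarith
      nlinarith
    · have : 0 < (t2 - y) * Ey := by apply mul_pos _ hEy; linarith
      nlinarith
  have a1 : 0 ≤ ((y - t2) * Ey - R * (y - t1)) * (t1 - x) := mul_nonneg h (by linarith)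
  have a2 : 0 < (t2 - t1) * (y - x) * Ey := mul_pos (mul_pos (by linarith) (by linarith)) hEy
  have a3 : 0 < (t2 - x) * (t1 - y) * (Ey - Ex) :=
    mul_pos (mul_pos (by linarith) (by linarith)) (by linarith)
  have : 0 < (t1 - y) * ((x - t2) * Ex - R * (x - t1)) := by nlinarith
  exact (mul_pos_iff_of_pos_left (by linarith)).1 this

lemma N_right {t1 t2 R α x y : ℝ} (ht1 : 0 < t1) (ht : t1 < t2) (hR : 0 < R) (hα : 0 < α)
    (hx : t1 ≤ x) (hxy : x < y)
    (h : 0 ≤ (x - t2) * exp (-α / x) - R * (x - t1)) :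
    0 < (y - t2) * exp (-α / y) - R * (y - t1) := by
  have hE : exp (-α / x) < exp (-α / y) := by
    apply exp_lt_exp.2
    rw [neg_div, neg_div]
    exact neg_lt_neg (div_lt_div_of_pos_left hα (by linarith) hxy)
  have hEx := exp_pos (-α / x)
  have hEy := exp_pos (-α / y)
  generalize exp (-α / x) = Ex at *
  generalize exp (-α / y) = Ey at *
  have hy1 : t2 < x := by
    by_contra hc
    push Not at hc
    have h1 : 0 ≤ R * (x - t1) := by apply mul_nonneg hR.le; linarith
    have h2 : 0 ≤ (t2 - x) * Ex := by apply mul_nonneg _ hEx.le; linarith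
    rcases hx.lt_or_eq with h3 | h3
    · have : 0 < R * (x - t1) := by apply mul_pos hR; linarith
      nlinarith
    · have : 0 < (t2 - x) * Ex := by apply mul_pos _ hEx; linarith
      nlinarith
  have a1 : 0 ≤ ((x - t2) * Ex - R * (x - t1)) * (y - t1) := mul_nonneg h (by linarith)
  have a2 : 0 < (t2 - t1) * (y - x) * Ex := mul_pos (mul_pos (by linarith) (by linarith)) hEx
  have a3 : 0 < (y - t2) * (x - t1) * (Ey - Ex) :=
    mul_pos (mul_pos (by linarith) (by linarith)) (by linarith)
  have : 0 < (x - t1) * ((y - t2) * Ey - R * (y - t1)) := by nlinarith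
  exact (mul_pos_iff_of_pos_left (by linarith)).1 this

noncomputable def phi (q t x : ℝ) : ℝ := x ^ (-(1/2) : ℝ) * exp (-(q * (t - x)^2) / (2 * x))
noncomputable def dphi (q t x : ℝ) : ℝ := phi q t x * (q * (x - t) / x)
noncomputable def bd (q x : ℝ) : ℝ := x ^ (-(1/2) : ℝ) * exp (-(q/2) * x)

lemma phi_meas (q t : ℝ) : Measurable (phi q t) := by unfold phi; fun_prop
lemma dphi_meas (q t : ℝ) : Measurable (dphi q t) := by
  unfold dphi; have := phi_meas q t; fun_prop
lemma bd_int {q : ℝ} (hq : 0 < q) : IntegrableOn (bd q) (Ioi 0) := by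
  have := integrableOn_rpow_mul_exp_neg_mul_rpow (p := 1) (s := -(1/2)) (b := q/2)
    (by norm_num) (by norm_num) (by positivity)
  refine this.congr_fun ?_ measurableSet_Ioi
  intro x _
  simp [bd]
lemma phi_eq {q t x : ℝ} (hx : 0 < x) :
    phi q t x = bd q x * (exp (q * t) * exp (-(q * t^2 / (2 * x)))) := by
  unfold phi bd
  rw [mul_assoc, ← exp_add, ← exp_add]
  congr 2
  field_simp
  ring
lemma bd_pos {q x : ℝ} (hx : 0 < x) : 0 < bd q x := by unfold bd; positivity
lemma phi_pos {q t x : ℝ} (hx : 0 < x) : 0 < phi q t x := by unfold phi; positivity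

lemma phi_le {q t T x : ℝ} (hq : 0 < q) (hx : 0 < x) (ht : t ≤ T) : 
    phi q t x ≤ exp (q * T) * bd q x := by
  rw [phi_eq hx, mul_comm]
  apply mul_le_mul_of_nonneg_right _ (bd_pos hx).le
  have h1 : exp (q * t) ≤ exp (q * T) := exp_le_exp.2 (by nlinarith)
  have h2 : exp (-(q * t^2 / (2 * x))) ≤ 1 := exp_le_one_iff.2 (by have : 0 ≤ q * t^2 / (2 * x) := by positivity
                                                                   linarith)
  calc _ ≤ exp (q * T) * 1 := mul_le_mul h1 h2 (exp_pos _).le (exp_pos _).le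
    _ = _ := mul_one _

lemma dphi_le {q t T τ x : ℝ} (hq : 0 < q) (hx : 0 < x) (hτ : 0 < τ) (hτt : τ ≤ t) (ht : t ≤ T) :
    |dphi q t x| ≤ (exp (q * T) * (q + 2 / τ)) * bd q x := by
  have ht0 : 0 < t := by linarith
  have hb := bd_pos (q := q) hx
  rw [dphi, abs_mul, abs_of_pos (phi_pos hx), phi_eq hx]
  have h1 : exp (q * t) ≤ exp (q * T) := exp_le_exp.2 (by nlinarith)
  have h2 : exp (-(q * t^2 / (2 * x))) ≤ 1 := exp_le_one_iff.2 (by have : 0 ≤ q * t^2 / (2 * x) := by positivity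
                                                                   linarith)
  have h3 : |q * (x - t) / x| ≤ q + q * t / x := by
    have e : q * (x - t) / x = q - q * t / x := by field_simp
    rw [e]
    have : 0 ≤ q * t / x := by positivity
    rw [abs_le]; constructor <;> linarith
  have h4 : exp (-(q * t^2 / (2 * x))) * (q * t^2 / (2 * x)) ≤ 1 := by
    rw [exp_neg, inv_mul_le_iff₀ (exp_pos _), mul_one]
    have := add_one_le_exp (q * t^2 / (2 * x)); linarith
  have h5 : exp (-(q * t^2 / (2 * x))) * (q * t / x) ≤ 2 / τ := by
    have e : exp (-(q * t^2 / (2 * x))) * (q * t / x) =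
        (2 / t) * (exp (-(q * t^2 / (2 * x))) * (q * t^2 / (2 * x))) := by
      field_simp
    rw [e]
    calc _ ≤ (2 / t) * 1 := by gcongr
      _ ≤ 2 / τ := by rw [mul_one]; gcongr
  have h6 : exp (-(q * t^2 / (2 * x))) * |q * (x - t) / x| ≤ q + 2 / τ := by
    calc _ ≤ exp (-(q * t^2 / (2 * x))) * (q + q * t / x) := by gcongr
      _ ≤ _ := by nlinarith
  calc _ = bd q x * (exp (q * t) * (exp (-(q * t^2 / (2 * x))) * |q * (x - t) / x|)) := by ring
    _ ≤ bd q x * (exp (q * T) * (q + 2 / τ)) := by gcongr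
    _ = _ := by ring

lemma dphi_int {q t : ℝ} (hq : 0 < q) (ht : 0 < t) {w : ℝ → ℝ} (hw : Measurable w) {M : ℝ}
    (hM : ∀ x, 0 < x → |w x| ≤ M) : IntegrableOn (fun x => dphi q t x * w x) (Ioi 0) := by
  have := ((bd_int hq).const_mul (exp (q * t) * (q + 2 / t))).mul_const M
  refine Integrable.mono' this ((dphi_meas q t).mul hw).aestronglyMeasurable ?_
  filter_upwards [ae_restrict_mem measurableSet_Ioi] with x hx
  rw [norm_mul, norm_eq_abs, norm_eq_abs]
  exact mul_le_mul (dphi_le hq hx ht le_rfl le_rfl) (hM x hx) (abs_nonneg _)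
    (mul_nonneg (by positivity) (bd_pos hx).le)

lemma phi_int {q t : ℝ} (hq : 0 < q) {w : ℝ → ℝ} (hw : Measurable w) {M : ℝ}
    (hM : ∀ x, 0 < x → |w x| ≤ M) : IntegrableOn (fun x => phi q t x * w x) (Ioi 0) := by
  have := ((bd_int hq).const_mul (exp (q * t))).mul_const M
  refine Integrable.mono' this ((phi_meas q t).mul hw).aestronglyMeasurable ?_
  filter_upwards [ae_restrict_mem measurableSet_Ioi] with x hx
  rw [norm_mul, norm_eq_abs, norm_eq_abs, abs_of_pos (phi_pos hx)]
  exact mul_le_mul (phi_le hq hx le_rfl) (hM x hx) (abs_nonneg _)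
    (mul_nonneg (by positivity) (bd_pos hx).le)

lemma phi_deriv (q t x : ℝ) (hx : 0 < x) : HasDerivAt (fun t => phi q t x) (dphi q t x) t := by
  have h : HasDerivAt (fun t => -(q * (t - x)^2) / (2 * x)) (q * (x - t) / x) t := by
    have := (((((hasDerivAt_id t).sub_const x).pow 2).const_mul q).neg).div_const (2 * x)
    refine this.congr_deriv ?_
    simp; field_simp; ring
  have := (h.exp).const_mul (x ^ (-(1/2) : ℝ))
  refine this.congr_deriv ?_
  unfold dphi phi; ring

lemma F_deriv {q t : ℝ} (hq : 0 < q) (ht : 0 < t) {w : ℝ → ℝ} (hw : Measurable w) {M : ℝ}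
    (hM : ∀ x, 0 < x → |w x| ≤ M) :
    HasDerivAt (fun t => ∫ x in Ioi (0:ℝ), phi q t x * w x)
      (∫ x in Ioi (0:ℝ), dphi q t x * w x) t := by
  have hs : Ioo (t/2) (2*t) ∈ nhds t := Ioo_mem_nhds (by linarith) (by linarith)
  refine (hasDerivAt_integral_of_dominated_loc_of_deriv_le (μ := volume.restrict (Ioi 0))
    (F := fun t x => phi q t x * w x) (F' := fun t x => dphi q t x * w x)
    (bound := fun x => (exp (q * (2*t)) * (q + 2 / (t/2))) * bd q x * M)
    hs ?_ ?_ ?_ ?_ ?_ ?_).2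
  · exact Filter.Eventually.of_forall fun s => ((phi_meas q s).mul hw).aestronglyMeasurable
  · exact phi_int hq hw hM
  · exact ((dphi_meas q t).mul hw).aestronglyMeasurable
  · filter_upwards [ae_restrict_mem measurableSet_Ioi] with x hx s hs
    rw [norm_mul, norm_eq_abs, norm_eq_abs]
    exact mul_le_mul (dphi_le hq hx (by linarith) hs.1.le hs.2.le) (hM x hx) (abs_nonneg _)
      (mul_nonneg (by positivity) (bd_pos hx).le)
  · exact ((bd_int hq).const_mul _).mul_const M
  · filter_upwards [ae_restrict_mem measurableSet_Ioi] with x hx s hs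
    exact (phi_deriv q s x hx).mul_const _

lemma F_cont {q : ℝ} (t : ℝ) (hq : 0 < q) {w : ℝ → ℝ} (hw : Measurable w) {M : ℝ}
    (hM : ∀ x, 0 < x → |w x| ≤ M) :
    ContinuousAt (fun t => ∫ x in Ioi (0:ℝ), phi q t x * w x) t := by
  refine continuousAt_of_dominated (bound := fun x => exp (q * (t+1)) * bd q x * M) ?_ ?_ ?_ ?_
  · exact Filter.Eventually.of_forall fun s => ((phi_meas q s).mul hw).aestronglyMeasurable
  · filter_upwards [Iio_mem_nhds (show t < t + 1 by linarith)] with s hs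
    filter_upwards [ae_restrict_mem measurableSet_Ioi] with x hx
    rw [norm_mul, norm_eq_abs, norm_eq_abs, abs_of_pos (phi_pos hx)]
    exact mul_le_mul (phi_le hq hx (le_of_lt hs)) (hM x hx) (abs_nonneg _)
      (mul_nonneg (by positivity) (bd_pos hx).le)
  · exact ((bd_int hq).const_mul _).mul_const M
  · filter_upwards [ae_restrict_mem measurableSet_Ioi] with x hx
    exact (phi_deriv q t x hx).continuousAt.mul_const _

lemma dphi_int0 {q t : ℝ} (hq : 0 < q) (ht : 0 < t) : IntegrableOn (dphi q t) (Ioi 0) := by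
  have := dphi_int hq ht (w := fun _ => 1) measurable_const (M := 1) (by simp)
  simpa using this

lemma dphi_zero {q t : ℝ} (hq : 0 < q) (ht : 0 < t) : ∫ x in Ioi (0:ℝ), dphi q t x = 0 := by
  let e : ℝ → ℝ := fun w => exp (-(q/2) * w^2)
  have he : Continuous e := by fun_prop
  let v : ℝ → ℝ := fun x => √x + t / √x
  let L : ℝ := ∫ x in Ioi (0:ℝ), e x
  let H : ℝ → ℝ := fun x => 2 * q * exp (2 * q * t) * ∫ w in (0:ℝ)..v x, e w
  have hei : IntegrableOn e (Ioi 0) := (integrable_exp_neg_mul_sq (by positivity)).integrableOn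
  have hH : ∀ (l : Filter ℝ) [l.IsCountablyGenerated], Filter.Tendsto v l Filter.atTop → 
      Filter.Tendsto H l (nhds (2 * q * exp (2 * q * t) * L)) := fun l _ hl =>
    (intervalIntegral_tendsto_integral_Ioi 0 hei hl).const_mul _
  have hsq0 : Filter.Tendsto (fun x : ℝ => √x) (nhdsWithin 0 (Ioi 0)) (nhdsWithin 0 (Ioi 0)) := by
    apply tendsto_nhdsWithin_iff.2 ⟨?_, ?_⟩
    · have := (Real.continuous_sqrt.tendsto 0).mono_left (nhdsWithin_le_nhds (s := Ioi 0))
      simpa using this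
    · filter_upwards [self_mem_nhdsWithin] with x hx
      exact Real.sqrt_pos.2 hx
  have hv0 : Filter.Tendsto v (nhdsWithin 0 (Ioi 0)) Filter.atTop := by
    have h1 : Filter.Tendsto (fun x : ℝ => t / √x) (nhdsWithin 0 (Ioi 0)) Filter.atTop := by
      simp only [div_eq_mul_inv]
      exact (tendsto_inv_nhdsGT_zero.comp hsq0).const_mul_atTop ht
    refine Filter.tendsto_atTop_mono (fun x => ?_) h1
    have := Real.sqrt_nonneg x
    simp only [v]; linarith
  have hv1 : Filter.Tendsto v Filter.atTop Filter.atTop := by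
    refine Filter.tendsto_atTop_mono (fun x => ?_) Real.tendsto_sqrt_atTop
    have : 0 ≤ t / √x := by positivity
    simp only [v]; linarith
  have hd : ∀ x, 0 < x → HasDerivAt H (dphi q t x) x := by
    intro x hx
    have hs := Real.sqrt_pos.2 hx
    have h1 := Real.hasDerivAt_sqrt hx.ne'
    have h2 : HasDerivAt v _ x := h1.add (h1.inv hs.ne' |>.const_mul t)
    have h3 : HasDerivAt (fun u => ∫ w in (0:ℝ)..u, e w) (e (v x)) (v x) :=
      (he.integral_hasStrictDerivAt 0 (v x)).hasDerivAt
    have h4 := (h3.comp x h2).const_mul (2 * q * exp (2 * q * t))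
    refine h4.congr_deriv ?_
    unfold dphi phi
    have e1 : exp (2 * q * t) * e (v x) = exp (-(q * (t - x)^2) / (2 * x)) := by
      simp only [e]
      rw [← exp_add]
      congr 1
      have : (v x)^2 = x + 2 * t + t^2 / x := by
        simp only [v]
        rw [add_sq, div_pow, Real.sq_sqrt hx.le]
        field_simp
      rw [this]; field_simp; ring
    rw [← e1]
    have e2 : x ^ (-(1/2) : ℝ) = (√x)⁻¹ := by
      rw [Real.rpow_neg hx.le, Real.sqrt_eq_rpow]
    rw [e2]
    have hxx : x = √x ^ 2 := (Real.sq_sqrt hx.le).symm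
    generalize e (v x) = ee
    generalize exp (2 * q * t) = ee'
    generalize √x = r at *
    subst hxx
    field_simp
    ring
  have := integral_Ioi_of_hasDerivAt_of_tendsto (a := 0) (m := 2 * q * exp (2 * q * t) * L)
    (f := Function.update H 0 (2 * q * exp (2 * q * t) * L)) (f' := dphi q t) ?_ ?_ (dphi_int0 hq ht) ?_
  · simpa using this
  · rw [continuousWithinAt_update_same]
    simpa using hH _ hv0
  · intro x hx
    refine (hd x hx).congr_of_eventuallyEq ?_
    filter_upwards [Ioi_mem_nhds hx] with y hy
    exact Function.update_of_ne (ne_of_gt hy) _ _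
  · refine (hH _ hv1).congr' ?_
    filter_upwards [Filter.eventually_gt_atTop 0] with y hy
    exact (Function.update_of_ne (ne_of_gt hy) _ _).symm

lemma cheb {S : Set ℝ} (hS : MeasurableSet S) {D w : ℝ → ℝ} {m c : ℝ} (hD : IntegrableOn D S)
    (hDw : IntegrableOn (fun x => D x * w x) S) (h0 : ∫ x in S, D x = 0)
    (h : ∀ x ∈ S, x ≠ c → D x ≠ 0 ∧ D x * (w x - m) ≤ 0) :
    ∫ x in S, D x * w x ≤ 0 ∧ (∫ x in S, D x * w x = 0 → w =ᵐ[volume.restrict S] fun _ => m) := by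
  have hi : IntegrableOn (fun x => D x * (m - w x)) S := by
    have := (hD.mul_const m).sub hDw
    refine this.congr (Filter.Eventually.of_forall fun x => ?_)
    simp; ring
  have e : ∫ x in S, D x * (m - w x) = - ∫ x in S, D x * w x := by
    have := integral_sub (hD.mul_const m) hDw
    rw [integral_mul_const, h0, zero_mul, zero_sub] at this
    rw [← this]; congr 1; ext x; ring
  have hc : ∀ᵐ x ∂(volume.restrict S), x ∈ S ∧ x ≠ c := by
    filter_upwards [ae_restrict_mem hS, Measure.ae_ne (volume.restrict S) c] with x h1 h2 using ⟨h1, h2⟩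
  have hn : 0 ≤ᵐ[volume.restrict S] fun x => D x * (m - w x) := by
    filter_upwards [hc] with x hx
    have := (h x hx.1 hx.2).2
    simp only [Pi.zero_apply]; nlinarith
  have := integral_nonneg_of_ae hn
  refine ⟨by linarith, fun h1 => ?_⟩
  have h2 := (setIntegral_eq_zero_iff_of_nonneg_ae hn hi).1 (by rw [e, h1, neg_zero])
  filter_upwards [hc, h2] with x hx hx2
  have h3 := (h x hx.1 hx.2).1
  simp only [Pi.zero_apply, mul_eq_zero, h3, false_or] at hx2
  linarith

lemma exists_left {D w : ℝ → ℝ} {x0 : ℝ} (hw : ∀ x, 0 ≤ w x)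
    (hmono : MonotoneOn w (Ioi 0 ∩ Iic x0))
    (h : ∀ x y, 0 < x → x < y → y ≤ x0 → 0 ≤ D y → 0 < D x) :
    ∃ m c, ∀ x ∈ Ioc 0 x0, x ≠ c → D x ≠ 0 ∧ D x * (w x - m) ≤ 0 := by
  by_cases hZ : ∃ z, z ∈ Ioc 0 x0 ∧ 0 ≤ D z
  · obtain ⟨z, hz, hDz⟩ := hZ
    set Z := {z | z ∈ Ioc 0 x0 ∧ 0 ≤ D z}
    have hb : BddAbove Z := ⟨x0, fun z hz => hz.1.2⟩
    have hne : Z.Nonempty := ⟨z, hz, hDz⟩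
    have hc0 : 0 < sSup Z := lt_of_lt_of_le hz.1 (le_csSup hb ⟨hz, hDz⟩)
    have hc1 : sSup Z ≤ x0 := csSup_le hne fun z hz => hz.1.2
    refine ⟨w (sSup Z), sSup Z, fun x hx hxc => ?_⟩
    rcases lt_or_gt_of_ne hxc with h1 | h1
    · obtain ⟨z, hz, hxz⟩ := exists_lt_of_lt_csSup hne h1
      have := h x z hx.1 hxz hz.1.2 hz.2
      refine ⟨this.ne', mul_nonpos_of_nonneg_of_nonpos this.le ?_⟩
      linarith [hmono ⟨hx.1, hx.2⟩ ⟨hc0, hc1⟩ h1.le]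
    · have : D x < 0 := by
        by_contra hn
        push Not at hn
        exact absurd (le_csSup hb (show x ∈ Z from ⟨hx, hn⟩)) (not_le.2 h1)
      refine ⟨this.ne, mul_nonpos_of_nonpos_of_nonneg this.le ?_⟩
      linarith [hmono ⟨hc0, hc1⟩ ⟨hx.1, hx.2⟩ h1.le]
  · push Not at hZ
    refine ⟨0, 0, fun x hx _ => ⟨(hZ x hx).ne, ?_⟩⟩
    have := hZ x hx
    have := hw x
    nlinarith

lemma exists_right {D w : ℝ → ℝ} {x0 : ℝ} (hx0 : 0 < x0) (hw : ∀ x, 0 ≤ w x)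
    (hanti : AntitoneOn w (Ioi 0 ∩ Ici x0))
    (h : ∀ x y, x0 < x → x < y → 0 ≤ D x → 0 < D y) :
    ∃ m c, ∀ x ∈ Ioi x0, x ≠ c → D x ≠ 0 ∧ D x * (w x - m) ≤ 0 := by
  by_cases hZ : ∃ z, z ∈ Ioi x0 ∧ 0 ≤ D z
  · obtain ⟨z, hz, hDz⟩ := hZ
    set Z := {z | z ∈ Ioi x0 ∧ 0 ≤ D z}
    have hb : BddBelow Z := ⟨x0, fun z hz => le_of_lt hz.1⟩
    have hne : Z.Nonempty := ⟨z, hz, hDz⟩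
    have hc1 : x0 ≤ sInf Z := le_csInf hne fun z hz => le_of_lt hz.1
    have hc0 : 0 < sInf Z := by linarith
    refine ⟨w (sInf Z), sInf Z, fun x hx hxc => ?_⟩
    have hx' : x0 < x := hx
    rcases lt_or_gt_of_ne hxc with h1 | h1
    · have : D x < 0 := by
        by_contra hn
        push Not at hn
        exact absurd (csInf_le hb (show x ∈ Z from ⟨hx, hn⟩)) (not_le.2 h1)
      refine ⟨this.ne, mul_nonpos_of_nonpos_of_nonneg this.le ?_⟩
      linarith [hanti ⟨hx0.trans hx', hx'.le⟩ ⟨hc0, hc1⟩ h1.le]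
    · obtain ⟨z, hz, hxz⟩ := exists_lt_of_csInf_lt hne h1
      have := h z x hz.1 hxz hz.2
      refine ⟨this.ne', mul_nonpos_of_nonneg_of_nonpos this.le ?_⟩
      linarith [hanti ⟨hc0, hc1⟩ ⟨hx0.trans hx', hx'.le⟩ h1.le]
  · push Not at hZ
    refine ⟨0, 0, fun x hx _ => ⟨(hZ x hx).ne, ?_⟩⟩
    have := hZ x hx
    have := hw x
    nlinarith

lemma setInt_pos {S : Set ℝ} (hS : MeasurableSet S) (hv : volume S ≠ 0) {D : ℝ → ℝ}
    (hD : IntegrableOn D S) (h : ∀ x ∈ S, 0 < D x) : 0 < ∫ x in S, D x := by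
  rw [setIntegral_pos_iff_support_of_nonneg_ae _ hD]
  · refine lt_of_lt_of_le (pos_iff_ne_zero.2 hv) (measure_mono fun x hx => ⟨(h x hx).ne', hx⟩)
  · filter_upwards [ae_restrict_mem hS] with x hx using (h x hx).le

lemma split_int {D : ℝ → ℝ} {x0 : ℝ} (hx0 : 0 < x0) (hD : IntegrableOn D (Ioi 0)) :
    ∫ x in Ioi (0:ℝ), D x = (∫ x in Ioc 0 x0, D x) + ∫ x in Ioi x0, D x := by
  rw [← Ioc_union_Ioi_eq_Ioi hx0.le]
  exact setIntegral_union (Set.Ioc_disjoint_Ioi le_rfl) measurableSet_Ioi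
    (hD.mono_set Ioc_subset_Ioi_self) (hD.mono_set (Ioi_subset_Ioi hx0.le))

lemma G_neg {q t x0 : ℝ} (hq : 0 < q) (ht : 0 < t) (hx0 : 0 < x0) :
    ∫ x in Ioc 0 x0, dphi q t x < 0 := by
  have hi := dphi_int0 hq ht
  have h0 := dphi_zero hq ht
  rw [split_int hx0 hi] at h0
  have hi1 := hi.mono_set (show Ioc 0 x0 ⊆ Ioi 0 from Ioc_subset_Ioi_self)
  have hi2 := hi.mono_set (Ioi_subset_Ioi hx0.le)
  rcases lt_or_ge x0 t with h | h
  · have := setInt_pos measurableSet_Ioc (by simp [hx0]) hi1.neg (fun x hx => by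
      have hx1 := hx.1
      have hx2 := hx.2
      have h1 : 0 < phi q t x * (q * (t - x) / x) :=
        mul_pos (phi_pos hx.1) (div_pos (mul_pos hq (by linarith)) hx1)
      have : -dphi q t x = phi q t x * (q * (t - x) / x) := by unfold dphi; ring
      simp only [Pi.neg_apply]; linarith)
    simp only [Pi.neg_apply] at this
    rw [integral_neg] at this; linarith
  · have := setInt_pos measurableSet_Ioi (by simp) hi2 (fun x hx => by
      have hx1 : x0 < x := hx
      have hx2 : 0 < x := by linarith
      exact mul_pos (phi_pos hx2) (div_pos (mul_pos hq (by linarith)) hx2))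
    linarith

lemma D_eq {q t1 t2 R x : ℝ} (hx : 0 < x) :
    dphi q t2 x - R * dphi q t1 x = (bd q x * q / x * (exp (q * t2) * exp (-(q * t1^2 / (2*x))))) *
      ((x - t2) * exp (-(q * (t2^2 - t1^2) / 2) / x) - (R * exp (q * (t1 - t2))) * (x - t1)) := by
  unfold dphi
  rw [phi_eq hx, phi_eq hx]
  have e1 : exp (-(q * t2^2 / (2*x))) = exp (-(q * t1^2 / (2*x))) * exp (-(q * (t2^2 - t1^2) / 2) / x) := by
    rw [← exp_add]; congr 1; field_simp; ring
  have e2 : exp (q * t1) = exp (q * t2) * exp (q * (t1 - t2)) := by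
    rw [← exp_add]; congr 1; ring
  rw [e1, e2]; ring

lemma core {q t1 t2 x0 : ℝ} (hq : 0 < q) (ht1 : 0 < t1) (ht : t1 < t2) (hx0 : 0 < x0)
    {w : ℝ → ℝ} (hwm : Measurable w) {M : ℝ}
    (hM : ∀ x, 0 < x → |w x| ≤ M) (hw : ∀ x, 0 ≤ w x)
    (hmono : MonotoneOn w (Ioi 0 ∩ Iic x0)) (hanti : AntitoneOn w (Ioi 0 ∩ Ici x0))
    (hwi : IntegrableOn w (Ioi x0)) (hw0 : ¬ w =ᵐ[volume.restrict (Ioi 0)] 0)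
    (hJ : ∫ x in Ioi (0:ℝ), dphi q t1 x * w x ≤ 0) :
    ∫ x in Ioi (0:ℝ), dphi q t2 x * w x < 0 := by
  have ht2 : 0 < t2 := by linarith
  have G1 := G_neg hq ht1 hx0
  have G2 := G_neg hq ht2 hx0
  have hi1 := dphi_int0 hq ht1
  have hi2 := dphi_int0 hq ht2
  have hj1 := dphi_int hq ht1 hwm hM
  have hj2 := dphi_int hq ht2 hwm hM
  set R := (∫ x in Ioc 0 x0, dphi q t2 x) / (∫ x in Ioc 0 x0, dphi q t1 x) with hRdef
  have hR : 0 < R := div_pos_of_neg_of_neg G2 G1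
  have hRe : (∫ x in Ioc 0 x0, dphi q t2 x) = R * (∫ x in Ioc 0 x0, dphi q t1 x) := by
    rw [hRdef, div_mul_cancel₀ _ G1.ne]
  clear_value R
  set D : ℝ → ℝ := fun x => dphi q t2 x - R * dphi q t1 x with hD
  have hDi : IntegrableOn D (Ioi 0) := hi2.sub (hi1.const_mul R)
  have hDwi : IntegrableOn (fun x => D x * w x) (Ioi 0) := by
    have := hj2.sub (hj1.const_mul R)
    refine this.congr (Filter.Eventually.of_forall fun x => ?_)
    simp [D]; ring
  have s1 : Ioc 0 x0 ⊆ Ioi (0:ℝ) := Ioc_subset_Ioi_self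
  have s2 : Ioi x0 ⊆ Ioi (0:ℝ) := Ioi_subset_Ioi hx0.le
  have hDw : ∫ x in Ioi (0:ℝ), D x * w x = (∫ x in Ioi (0:ℝ), dphi q t2 x * w x) -
      R * ∫ x in Ioi (0:ℝ), dphi q t1 x * w x := by
    rw [← integral_const_mul, ← integral_sub hj2 (hj1.const_mul R)]
    congr 1; ext x; simp [D]; ring
  have hDt : ∫ x in Ioi (0:ℝ), D x = 0 := by
    simp only [D]
    rw [integral_sub hi2 (hi1.const_mul R), integral_const_mul, dphi_zero hq ht1, dphi_zero hq ht2]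
    simp
  have hDl : ∫ x in Ioc 0 x0, D x = 0 := by
    simp only [D]
    rw [integral_sub (hi2.mono_set s1) ((hi1.mono_set s1).const_mul R), integral_const_mul, hRe]
    simp
  have hDr : ∫ x in Ioi x0, D x = 0 := by
    rw [split_int hx0 hDi, hDl] at hDt; linarith
  have hα : 0 < q * (t2^2 - t1^2) / 2 := by
    have : 0 < t2^2 - t1^2 := by nlinarith
    positivity
  have hR' : 0 < R * exp (q * (t1 - t2)) := by positivity
  have hP : ∀ x, 0 < x → 0 < bd q x * q / x * (exp (q * t2) * exp (-(q * t1^2 / (2*x)))) := by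
    intro x hx
    have := bd_pos (q := q) hx
    positivity
  have patL : ∀ x y, 0 < x → x < y → y ≤ t2 → 0 ≤ D y → 0 < D x := by
    intro x y hx hxy hy h
    have hy0 : 0 < y := by linarith
    simp only [D] at h ⊢
    rw [D_eq hy0] at h
    rw [D_eq hx]
    exact mul_pos (hP x hx) (N_left ht hR' hα hx hxy hy (nonneg_of_mul_nonneg_right h (hP y hy0)))
  have patR : ∀ x y, t1 ≤ x → x < y → 0 ≤ D x → 0 < D y := by
    intro x y hx hxy h
    have hx0 : 0 < x := by linarith
    have hy0 : 0 < y := by linarith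
    simp only [D] at h ⊢
    rw [D_eq hx0] at h
    rw [D_eq hy0]
    exact mul_pos (hP y hy0) (N_right ht1 ht hR' hα hx hxy (nonneg_of_mul_nonneg_right h (hP x hx0)))
  have patL' : ∀ x y, 0 < x → x < y → y ≤ x0 → 0 ≤ D y → 0 < D x := by
    intro x y hx hxy hy h
    rcases le_or_gt y t2 with hy2 | hy2
    · exact patL x y hx hxy hy2 h
    · exfalso
      have := setInt_pos measurableSet_Ioi (by simp) (hDi.mono_set s2) (fun z hz => 
        patR y z (by linarith) (lt_of_le_of_lt hy hz) h)
      linarith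
  have patR' : ∀ x y, x0 < x → x < y → 0 ≤ D x → 0 < D y := by
    intro x y hx hxy h
    rcases le_or_gt t1 x with hy2 | hy2
    · exact patR x y hy2 hxy h
    · exfalso
      have := setInt_pos measurableSet_Ioc (by simp [hx0]) (hDi.mono_set s1) (fun z hz => 
        patL z x hz.1 (lt_of_le_of_lt hz.2 hx) (by linarith) h)
      linarith
  obtain ⟨m, c, hmc⟩ := exists_left hw hmono patL'
  obtain ⟨m', c', hmc'⟩ := exists_right hx0 hw hanti patR'
  obtain ⟨l1, l2⟩ := cheb measurableSet_Ioc (hDi.mono_set s1) (hDwi.mono_set s1) hDl hmc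
  obtain ⟨r1, r2⟩ := cheb measurableSet_Ioi (hDi.mono_set s2) (hDwi.mono_set s2) hDr hmc'
  rw [split_int hx0 hDwi] at hDw
  by_contra hcon
  push Not at hcon
  have hRJ : R * ∫ x in Ioi (0:ℝ), dphi q t1 x * w x ≤ 0 :=
    mul_nonpos_of_nonneg_of_nonpos hR.le hJ
  have l3 := l2 (by linarith)
  have r3 := r2 (by linarith)
  have hJ0 : ∫ x in Ioi (0:ℝ), dphi q t1 x * w x = 0 := by
    have : R * ∫ x in Ioi (0:ℝ), dphi q t1 x * w x = 0 := by linarith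
    exact (mul_eq_zero.1 this).resolve_left hR.ne'
  have hm' : m' = 0 := by
    have : IntegrableOn (fun _ => m') (Ioi x0) := hwi.congr r3
    rw [integrableOn_const_iff] at this
    simpa using this
  subst hm'
  rw [split_int hx0 hj1] at hJ0
  have k1 : ∫ x in Ioc 0 x0, dphi q t1 x * w x = (∫ x in Ioc 0 x0, dphi q t1 x) * m := by
    rw [← integral_mul_const]
    apply integral_congr_ae
    filter_upwards [l3] with x hx
    rw [hx]
  have k2 : ∫ x in Ioi x0, dphi q t1 x * w x = 0 := by
    apply integral_eq_zero_of_ae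
    filter_upwards [r3] with x hx
    simp [hx]
  have hm : m = 0 := by
    rw [k1, k2, add_zero] at hJ0
    exact (mul_eq_zero.1 hJ0).resolve_left G1.ne
  subst hm
  apply hw0
  rw [← Ioc_union_Ioi_eq_Ioi hx0.le]
  exact ae_restrict_union_iff _ _ _ |>.2 ⟨l3, r3⟩

lemma strict_int {h1 h2 w : ℝ → ℝ} (i1 : IntegrableOn h1 (Ioi 0)) (i2 : IntegrableOn h2 (Ioi 0))
    (hle : ∀ x, 0 < x → h1 x ≤ h2 x) (heq : ∀ x, 0 < x → h1 x = h2 x → w x = 0)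
    (hw0 : ¬ w =ᵐ[volume.restrict (Ioi 0)] 0) :
    ∫ x in Ioi (0:ℝ), h1 x < ∫ x in Ioi (0:ℝ), h2 x := by
  have hn : 0 ≤ᵐ[volume.restrict (Ioi 0)] fun x => h2 x - h1 x := by
    filter_upwards [ae_restrict_mem measurableSet_Ioi] with x hx
    simpa using hle x hx
  have e := integral_sub i2 i1
  have h3 := integral_nonneg_of_ae hn
  by_contra hc
  have h4 : ∫ x in Ioi (0:ℝ), (h2 x - h1 x) = 0 := by linarith
  have h5 := (setIntegral_eq_zero_iff_of_nonneg_ae hn (i2.sub i1)).1 h4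
  apply hw0
  filter_upwards [h5, ae_restrict_mem measurableSet_Ioi] with x hx hx0
  exact heq x hx0 (by simp at hx; linarith)

lemma uniq {q x0 : ℝ} (hq : 0 < q) (hx0 : 0 < x0)
    {w : ℝ → ℝ} (hwm : Measurable w) {M : ℝ}
    (hM : ∀ x, 0 < x → |w x| ≤ M) (hw : ∀ x, 0 ≤ w x)
    (hmono : MonotoneOn w (Ioi 0 ∩ Iic x0)) (hanti : AntitoneOn w (Ioi 0 ∩ Ici x0))
    (hwi : IntegrableOn w (Ioi x0)) (hw0 : ¬ w =ᵐ[volume.restrict (Ioi 0)] 0) {t1 t2 : ℝ}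
    (ht : t1 < t2)
    (h1 : IsLocalMax (fun t => ∫ x in Ioi (0:ℝ), phi q t x * w x) t1)
    (h2 : IsLocalMax (fun t => ∫ x in Ioi (0:ℝ), phi q t x * w x) t2) : False := by
  set F := (fun t => ∫ x in Ioi (0:ℝ), phi q t x * w x) with hF
  have hd : ∀ t, 0 < t → HasDerivAt F _ t := fun t ht => F_deriv hq ht hwm hM
  have hneg : ∀ t s, t < s → s ≤ 0 → F t < F s := by
    intro t s hts hs
    have hphi : ∀ x, 0 < x → phi q t x < phi q s x := by
      intro x hx
      unfold phi
      have : 0 < x ^ (-(1/2) : ℝ) := by positivity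
      refine mul_lt_mul_of_pos_left (exp_lt_exp.2 ?_) this
      refine div_lt_div_of_pos_right ?_ (by positivity)
      have : (s - x)^2 < (t - x)^2 := by nlinarith
      nlinarith
    refine strict_int (w := w) (phi_int hq hwm hM) (phi_int hq hwm hM) ?_ ?_ hw0
    · intro x hx
      exact mul_le_mul_of_nonneg_right (hphi x hx).le (hw x)
    · intro x hx h
      by_contra hne
      have := mul_right_cancel₀ hne h
      exact absurd this (hphi x hx).ne
  have hn : ∀ t, t < 0 → ¬ IsLocalMax F t := by
    intro t ht hl
    have h3 : ∀ᶠ s in nhdsWithin t (Ioi t), F s ≤ F t := hl.filter_mono nhdsWithin_le_nhds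
    obtain ⟨s, hs1, hs2⟩ := (h3.and (Ioo_mem_nhdsGT ht)).exists
    exact absurd (hneg t s hs2.1 hs2.2.le) (not_lt.2 hs1)
  have ht1 : 0 ≤ t1 := by
    by_contra hc
    exact hn t1 (not_le.1 hc) h1
  have ht2 : 0 < t2 := by linarith
  have z2 := h2.hasDerivAt_eq_zero (hd t2 ht2)
  rcases ht1.lt_or_eq with hp | hz
  · have z1 := h1.hasDerivAt_eq_zero (hd t1 hp)
    have := core hq hp ht hx0 hwm hM hw hmono hanti hwi hw0 z1.le
    linarith
  · subst hz
    have hm : StrictMonoOn F (Icc 0 t2) := by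
      apply strictMonoOn_of_deriv_pos (convex_Icc 0 t2)
      · exact fun t _ => (F_cont t hq hwm hM).continuousWithinAt
      · intro t ht
        rw [interior_Icc] at ht
        rw [(hd t ht.1).deriv]
        by_contra hc
        have := core hq ht.1 ht.2 hx0 hwm hM hw hmono hanti hwi hw0 (not_lt.1 hc)
        linarith
    have h3 : ∀ᶠ s in nhdsWithin 0 (Ioi 0), F s ≤ F 0 := h1.filter_mono nhdsWithin_le_nhds
    obtain ⟨s, hs1, hs2⟩ := (h3.and (Ioo_mem_nhdsGT ht2)).exists
    exact absurd (hm ⟨le_rfl, ht2.le⟩ ⟨hs2.1.le, hs2.2.le⟩ hs2.1) (not_lt.2 hs1)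

/-- Theorem 2(i): if `g*(x) = x^{-(p-1)/2} g(x)` is unimodal on `(0, ∞)`, then the
multivariate normal variance-mean mixture density `f` has at most one local maximum
point, which lies on the line `{μ + tβ : t ∈ ℝ}`. -/
theorem multivariate_mixture_unimodal
    (p : ℕ) (hp : 1 ≤ p)
    (μ β : Fin p → ℝ)
    (A : Matrix (Fin p) (Fin p) ℝ) (hA : IsUnit A.det)
    (g : ℝ → ℝ) (hg_meas : Measurable g) (hg_nonneg : ∀ x, 0 ≤ g x)
    (hg_supp : ∀ x ≤ 0, g x = 0)
    (hg_int : IntegrableOn g (Ioi 0))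
    (hg_pos : 0 < ∫ x in Ioi (0:ℝ), g x)
    (f : (Fin p → ℝ) → ℝ)
    (hf : ∀ y, f y = |A.det|⁻¹ * ∫ x in Ioi (0:ℝ),
      (2 * π * x) ^ (-(p:ℝ)/2) *
        Real.exp (-(∑ i, (A⁻¹.mulVec (y - μ - x • β) i) ^ 2) / (2 * x)) * g x)
    (hf_int : ∀ y, IntegrableOn (fun x =>
      (2 * π * x) ^ (-(p:ℝ)/2) *
        Real.exp (-(∑ i, (A⁻¹.mulVec (y - μ - x • β) i) ^ 2) / (2 * x)) * g x) (Ioi 0))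
    (hg_uni : ∃ x₀ ∈ Ioi (0:ℝ),
      MonotoneOn (fun x => x ^ (-((p:ℝ) - 1)/2) * g x) (Ioi 0 ∩ Iic x₀) ∧
      AntitoneOn (fun x => x ^ (-((p:ℝ) - 1)/2) * g x) (Ioi 0 ∩ Ici x₀)) :
    (∀ y₀ : Fin p → ℝ, IsLocalMax f y₀ → ∃ t : ℝ, y₀ = μ + t • β) ∧
    (∀ y₁ y₂ : Fin p → ℝ, IsLocalMax f y₁ → IsLocalMax f y₂ → y₁ = y₂) := by
  obtain ⟨x0, hx0, hmono, hanti⟩ := hg_uni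
  have hx0 : 0 < x0 := hx0
  set w : ℝ → ℝ := fun x => x ^ (-((p:ℝ) - 1)/2) * g x with hwdef
  have hwm : Measurable w := by simp only [hwdef]; fun_prop
  have hw : ∀ x, 0 ≤ w x := by
    intro x
    rcases le_or_gt x 0 with h | h
    · simp [hwdef, hg_supp x h]
    · exact mul_nonneg (Real.rpow_nonneg h.le _) (hg_nonneg x)
  have hM : ∀ x, 0 < x → |w x| ≤ w x0 := by
    intro x hx
    rw [abs_of_nonneg (hw x)]
    rcases le_total x x0 with h | h
    · exact hmono ⟨hx, h⟩ ⟨hx0, self_mem_Iic⟩ h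
    · exact hanti ⟨hx0, self_mem_Ici⟩ ⟨hx, h⟩ h
  have hp1 : (1:ℝ) ≤ p := by exact_mod_cast hp
  have hwi : IntegrableOn w (Ioi x0) := by
    have h1 : IntegrableOn (fun x => x0 ^ (-((p:ℝ) - 1)/2) * g x) (Ioi x0) :=
      (hg_int.mono_set (Ioi_subset_Ioi hx0.le)).const_mul _
    refine Integrable.mono' h1 hwm.aestronglyMeasurable ?_
    filter_upwards [ae_restrict_mem measurableSet_Ioi] with x hx
    rw [norm_eq_abs, abs_of_nonneg (hw x)]
    exact mul_le_mul_of_nonneg_right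
      (Real.rpow_le_rpow_of_nonpos hx0 (le_of_lt hx) (by linarith)) (hg_nonneg x)
  have hw0 : ¬ w =ᵐ[volume.restrict (Ioi 0)] 0 := by
    intro h
    have : ∫ x in Ioi (0:ℝ), g x = 0 := by
      apply integral_eq_zero_of_ae
      filter_upwards [h, ae_restrict_mem measurableSet_Ioi] with x hx hx0
      have h1 : 0 < x ^ (-((p:ℝ) - 1)/2) := Real.rpow_pos_of_pos hx0 _
      exact (mul_eq_zero.1 hx).resolve_left h1.ne'
    linarith
  have hg0 : ¬ g =ᵐ[volume.restrict (Ioi 0)] 0 := by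
    intro h
    have := integral_eq_zero_of_ae h
    linarith
  have hdet : 0 < |A.det|⁻¹ := inv_pos.2 (abs_pos.2 hA.ne_zero)
  set b : Fin p → ℝ := A⁻¹.mulVec β with hb
  have hAb : A.mulVec b = β := by
    rw [hb, Matrix.mulVec_mulVec, Matrix.mul_nonsing_inv A hA, Matrix.one_mulVec]
  have hinv : ∀ u : Fin p → ℝ, A⁻¹.mulVec (A.mulVec u) = u := by
    intro u
    rw [Matrix.mulVec_mulVec, Matrix.nonsing_inv_mul A hA, Matrix.one_mulVec]
  have part1 : ∀ y₀ : Fin p → ℝ, IsLocalMax f y₀ → ∃ t : ℝ, y₀ = μ + t • β := by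
    intro y₀ hy
    set z : Fin p → ℝ := A⁻¹.mulVec (y₀ - μ) with hz
    have hAz : A.mulVec z = y₀ - μ := by
      rw [hz, Matrix.mulVec_mulVec, Matrix.mul_nonsing_inv A hA, Matrix.one_mulVec]
    set t : ℝ := (∑ i, z i * b i) / (∑ i, b i ^ 2) with ht
    set u : Fin p → ℝ := z - t • b with hu
    have horth : ∑ i, u i * b i = 0 := by
      have e : ∑ i, u i * b i = (∑ i, z i * b i) - t * ∑ i, b i ^ 2 := by
        rw [Finset.mul_sum, ← Finset.sum_sub_distrib]
        apply Finset.sum_congr rfl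
        intro i _
        simp [hu]; ring
      rw [e]
      by_cases hq : ∑ i, b i ^ 2 = 0
      · have hb0 : ∀ i, b i = 0 := by
          intro i
          have := (Finset.sum_eq_zero_iff_of_nonneg (fun i _ => sq_nonneg (b i))).1 hq i (Finset.mem_univ i)
          exact pow_eq_zero_iff (two_ne_zero) |>.1 this
        simp [hb0]
      · rw [ht, div_mul_cancel₀ _ hq, sub_self]
    have hU : u = 0 := by
      by_contra hne
      have hUpos : 0 < ∑ i, u i ^ 2 := by
        obtain ⟨i, hi⟩ := Function.ne_iff.1 hne
        exact Finset.sum_pos' (fun i _ => sq_nonneg _) ⟨i, Finset.mem_univ i, by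
          have : u i ≠ 0 := hi
          positivity⟩
      have hsum : ∀ ε x : ℝ, ∑ i, (A⁻¹.mulVec (y₀ - ε • A.mulVec u - μ - x • β) i) ^ 2 =
          (t - x)^2 * (∑ i, b i ^ 2) + (1 - ε)^2 * ∑ i, u i ^ 2 := by
        intro ε x
        have e1 : A⁻¹.mulVec (y₀ - ε • A.mulVec u - μ - x • β) = (t - x) • b + (1 - ε) • u := by
          have : y₀ - ε • A.mulVec u - μ - x • β = (y₀ - μ) - ε • A.mulVec u - x • β := by abel
          rw [this, Matrix.mulVec_sub, Matrix.mulVec_sub, Matrix.mulVec_smul, Matrix.mulVec_smul,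
            hinv, ← hz, ← hb]
          have hz' : z = u + t • b := by rw [hu]; abel
          rw [hz']
          module
        rw [e1]
        have e2 : ∀ i, (((t - x) • b + (1 - ε) • u) i)^2 = (t-x)^2 * b i ^ 2 + (1-ε)^2 * u i ^ 2
            + 2 * (t - x) * (1 - ε) * (u i * b i) := by
          intro i; simp; ring
        simp only [e2]
        rw [Finset.sum_add_distrib, Finset.sum_add_distrib, ← Finset.mul_sum, ← Finset.mul_sum,
          ← Finset.mul_sum, horth]
        ring
      have hlt : ∀ ε : ℝ, 0 < ε → ε < 1 → f y₀ < f (y₀ - ε • A.mulVec u) := by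
        intro ε h0 h1
        have hk : ∀ x : ℝ, 0 < x → (2 * π * x) ^ (-(p:ℝ)/2) *
            Real.exp (-(∑ i, (A⁻¹.mulVec (y₀ - μ - x • β) i) ^ 2) / (2 * x)) <
            (2 * π * x) ^ (-(p:ℝ)/2) *
            Real.exp (-(∑ i, (A⁻¹.mulVec (y₀ - ε • A.mulVec u - μ - x • β) i) ^ 2) / (2 * x)) := by
          intro x hx
          have hpx : 0 < (2 * π * x) ^ (-(p:ℝ)/2) := by positivity
          refine mul_lt_mul_of_pos_left (exp_lt_exp.2 ?_) hpx
          refine div_lt_div_of_pos_right ?_ (by positivity)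
          have e0 := hsum 0 x
          rw [zero_smul, sub_zero] at e0
          rw [e0, hsum ε x]
          have : (1 - ε)^2 < (1 - 0)^2 := by nlinarith
          have := mul_lt_mul_of_pos_right this hUpos
          linarith
        rw [hf, hf]
        refine mul_lt_mul_of_pos_left ?_ hdet
        refine strict_int (w := g) (hf_int _) (hf_int _) ?_ ?_ hg0
        · intro x hx
          exact mul_le_mul_of_nonneg_right (hk x hx).le (hg_nonneg x)
        · intro x hx h
          by_contra hne
          exact absurd (mul_right_cancel₀ hne h) (hk x hx).ne
      have hc : Filter.Tendsto (fun ε : ℝ => y₀ - ε • A.mulVec u) (nhdsWithin 0 (Ioi 0)) (nhds y₀) := by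
        have : Continuous (fun ε : ℝ => y₀ - ε • A.mulVec u) := by fun_prop
        have := (this.tendsto 0).mono_left (nhdsWithin_le_nhds (s := Ioi 0))
        simpa using this
      obtain ⟨ε, h1, h2⟩ := ((hc.eventually hy).and (Ioo_mem_nhdsGT (zero_lt_one))).exists
      exact absurd (hlt ε h2.1 h2.2) (not_lt.2 h1)
    refine ⟨t, ?_⟩
    have hz' : z = t • b := sub_eq_zero.1 hU
    have : y₀ - μ = t • β := by rw [← hAz, hz', Matrix.mulVec_smul, hAb]
    rw [← this]; abel
  refine ⟨part1, ?_⟩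
  intro y₁ y₂ h1 h2
  obtain ⟨t1, e1⟩ := part1 y₁ h1
  obtain ⟨t2, e2⟩ := part1 y₂ h2
  by_cases hβ : β = 0
  · rw [e1, e2, hβ]; simp
  have hb0 : b ≠ 0 := by
    intro h
    rw [h, Matrix.mulVec_zero] at hAb
    exact hβ hAb.symm
  have hq : 0 < ∑ i, b i ^ 2 := by
    obtain ⟨i, hi⟩ := Function.ne_iff.1 hb0
    exact Finset.sum_pos' (fun i _ => sq_nonneg _) ⟨i, Finset.mem_univ i, by
      have : b i ≠ 0 := hi
      positivity⟩
  set q : ℝ := ∑ i, b i ^ 2 with hqdef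
  have hF : ∀ t : ℝ, f (μ + t • β) = (|A.det|⁻¹ * (2 * π) ^ (-(p:ℝ)/2)) *
      ∫ x in Ioi (0:ℝ), phi q t x * w x := by
    intro t
    rw [hf, mul_assoc]
    congr 1
    rw [← integral_const_mul]
    apply setIntegral_congr_fun measurableSet_Ioi
    intro x hx
    have hx : 0 < x := hx
    have e1 : A⁻¹.mulVec (μ + t • β - μ - x • β) = (t - x) • b := by
      have : μ + t • β - μ - x • β = (t - x) • β := by module
      rw [this, Matrix.mulVec_smul]
    have e2 : ∑ i, (A⁻¹.mulVec (μ + t • β - μ - x • β) i) ^ 2 = q * (t - x)^2 := by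
      rw [e1, hqdef, Finset.sum_mul]
      apply Finset.sum_congr rfl
      intro i _
      simp; ring
    have e3 : (2 * π * x) ^ (-(p:ℝ)/2) = (2 * π) ^ (-(p:ℝ)/2) *
        (x ^ (-(1/2) : ℝ) * x ^ (-((p:ℝ) - 1)/2)) := by
      rw [Real.mul_rpow (by positivity) hx.le, ← Real.rpow_add hx]
      congr 2; ring
    simp only [e2, e3, phi, hwdef]
    ring
  have hC : 0 < |A.det|⁻¹ * (2 * π) ^ (-(p:ℝ)/2) := by positivity
  have hloc : ∀ t : ℝ, IsLocalMax f (μ + t • β) →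
      IsLocalMax (fun t => ∫ x in Ioi (0:ℝ), phi q t x * w x) t := by
    intro t h
    have hc : Filter.Tendsto (fun t : ℝ => μ + t • β) (nhds t) (nhds (μ + t • β)) := by
      have : Continuous (fun t : ℝ => μ + t • β) := by fun_prop
      exact this.tendsto t
    have := hc.eventually h
    filter_upwards [this] with s hs
    rw [hF, hF] at hs
    exact le_of_mul_le_mul_left hs hC
  rw [e1] at h1
  rw [e2] at h2
  have l1 := hloc t1 h1
  have l2 := hloc t2 h2
  have : t1 = t2 := by
    rcases lt_trichotomy t1 t2 with h | h | h
    · exact (uniq hq hx0 hwm hM hw hmono hanti hwi hw0 h l1 l2).elim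
    · exact h
    · exact (uniq hq hx0 hwm hM hw hmono hanti hwi hw0 h l2 l1).elim
  rw [e1, e2, this]
end

section
/- Let p ≥ 1, let μ, β be vectors in ℝ^p, let A be an invertible p×p real matrix, let g be a nonnegative measurable function supported on (0,∞) with 0 < ∫₀^∞ g(x) dx < ∞, and define f(y) = |det A|^{-1} ∫₀^∞ (2πx)^{-p/2} · exp(−‖A⁻¹(y − μ − xβ)‖²/(2x)) · g(x) dx for y ∈ ℝ^p, assumed finite everywhere. If the function g*(x) = x^{−(p−1)/2} g(x) is nonincreasing on (0,∞), or if β = 0, then f(y) ≤ f(μ) for all y ∈ ℝ^p. -/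
open MeasureTheory Set Real Filter Topology

lemma aux_improper (F F' : ℝ → ℝ) (L l : ℝ) (h0 : Tendsto F (𝓝[>] 0) (𝓝 L))
    (hd : ∀ x ∈ Ioi (0:ℝ), HasDerivAt F (F' x) x) (hp : ∀ x ∈ Ioi (0:ℝ), 0 ≤ F' x)
    (hl : Tendsto F atTop (𝓝 l)) :
    IntegrableOn F' (Ioi 0) ∧ ∫ x in Ioi (0:ℝ), F' x = l - L := by
  set G := Function.update F 0 L with hG
  have hc : ContinuousWithinAt G (Ici 0) 0 := by
    rw [hG, continuousWithinAt_update_same]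
    simpa using h0
  have hd' : ∀ x ∈ Ioi (0:ℝ), HasDerivAt G (F' x) x := by
    intro x hx
    refine (hd x hx).congr_of_eventuallyEq ?_
    filter_upwards [Ioi_mem_nhds (mem_Ioi.1 hx)] with z hz
    exact Function.update_of_ne (ne_of_gt hz) _ _
  have hl' : Tendsto G atTop (𝓝 l) := by
    refine hl.congr' ?_
    filter_upwards [Ioi_mem_atTop (0:ℝ)] with z hz
    exact (Function.update_of_ne (ne_of_gt hz) _ _).symm
  refine ⟨integrableOn_Ioi_deriv_of_nonneg hc hd' hp hl', ?_⟩
  rw [integral_Ioi_of_hasDerivAt_of_nonneg hc hd' hp hl']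
  simp [hG]

noncomputable def auxPhi (z : ℝ) : ℝ := ∫ t in (0:ℝ)..z, Real.exp (-(1/2) * t ^ 2)

lemma auxPhi_deriv (z : ℝ) : HasDerivAt auxPhi (Real.exp (-(1/2) * z ^ 2)) z := by
  have hc : Continuous fun t : ℝ => Real.exp (-(1/2) * t ^ 2) := by fun_prop
  exact intervalIntegral.integral_hasDerivAt_right (hc.intervalIntegrable _ _)
    hc.aestronglyMeasurable.stronglyMeasurableAtFilter hc.continuousAt

lemma auxPhi_neg (z : ℝ) : auxPhi (-z) = - auxPhi z := by
  unfold auxPhi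
  have := intervalIntegral.integral_comp_neg (a := 0) (b := z)
    (fun t : ℝ => Real.exp (-(1/2) * t ^ 2))
  rw [intervalIntegral.integral_symm, neg_inj]
  simp only [neg_zero, neg_sq] at this
  exact this.symm

lemma auxPhi_top : Tendsto auxPhi atTop (𝓝 (√(π / (1/2)) / 2)) := by
  rw [← integral_gaussian_Ioi]
  exact intervalIntegral_tendsto_integral_Ioi 0
    ((integrable_exp_neg_mul_sq (by norm_num)).integrableOn) tendsto_id

lemma auxPhi_bot : Tendsto auxPhi atBot (𝓝 (-(√(π / (1/2)) / 2))) := by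
  have := (auxPhi_top.comp tendsto_neg_atBot_atTop).neg
  refine this.congr fun z => ?_
  simp [auxPhi_neg]

lemma aux_phi_int (r c : ℝ) (hr : 0 ≤ r) (hc : 0 < c) :
    IntegrableOn (fun x : ℝ => (√x)⁻¹ * Real.exp (-(r - c * x) ^ 2 / (2 * x))) (Ioi 0) ∧
    ∫ x in Ioi (0:ℝ), (√x)⁻¹ * Real.exp (-(r - c * x) ^ 2 / (2 * x))
      = c⁻¹ * (2 * (√(π / (1/2)) / 2)) := by
  set s := √(π / (1/2)) / 2 with hs
  set F : ℝ → ℝ := fun x => c⁻¹ * (auxPhi (c * √x - r * (√x)⁻¹)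
    - Real.exp (2 * r * c) * auxPhi (-(c * √x + r * (√x)⁻¹))) with hF
  have hsq : Tendsto (fun x : ℝ => √x) (𝓝[>] 0) (𝓝[>] 0) := by
    refine tendsto_nhdsWithin_iff.2 ⟨?_, ?_⟩
    · have := Real.continuous_sqrt.tendsto 0
      rw [Real.sqrt_zero] at this
      exact this.mono_left nhdsWithin_le_nhds
    · filter_upwards [self_mem_nhdsWithin] with x hx
      exact Real.sqrt_pos.2 hx
  have hd : ∀ x ∈ Ioi (0:ℝ), HasDerivAt F
      ((√x)⁻¹ * Real.exp (-(r - c * x) ^ 2 / (2 * x))) x := by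
    intro x hx
    have hx : 0 < x := hx
    have h1 := Real.hasDerivAt_sqrt hx.ne'
    have hp : 0 < √x := Real.sqrt_pos.2 hx
    have h2 := h1.inv hp.ne'
    have h3 := (auxPhi_deriv _).comp x ((h1.const_mul c).sub (h2.const_mul r))
    have h4 := (auxPhi_deriv _).comp x ((h1.const_mul c).add (h2.const_mul r)).neg
    have h5 := (h3.sub (h4.const_mul (Real.exp (2 * r * c)))).const_mul c⁻¹
    refine h5.congr_deriv ?_
    have e1 : Real.exp (-(1/2) * (c * √x - r * (√x)⁻¹) ^ 2)
        = Real.exp (-(r - c * x) ^ 2 / (2 * x)) := by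
      congr 1
      obtain ⟨q, hq, rfl⟩ : ∃ q, 0 < q ∧ x = q ^ 2 := ⟨√x, hp, (Real.sq_sqrt hx.le).symm⟩
      rw [Real.sqrt_sq hq.le]
      field_simp
      ring
    have e2 : Real.exp (2 * r * c) * Real.exp (-(1/2) * (-(c * √x + r * (√x)⁻¹)) ^ 2)
        = Real.exp (-(r - c * x) ^ 2 / (2 * x)) := by
      rw [← Real.exp_add]
      congr 1
      obtain ⟨q, hq, rfl⟩ : ∃ q, 0 < q ∧ x = q ^ 2 := ⟨√x, hp, (Real.sq_sqrt hx.le).symm⟩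
      rw [Real.sqrt_sq hq.le]
      field_simp
      ring
    simp only [Pi.neg_apply, Pi.add_apply, Pi.sub_apply, Pi.inv_apply] at *
    rw [← mul_assoc (Real.exp (2 * r * c)), e1, e2]
    field_simp
    ring
  have hinv : Tendsto (fun x : ℝ => (√x)⁻¹) atTop (𝓝 0) :=
    tendsto_inv_atTop_zero.comp Real.tendsto_sqrt_atTop
  have hct : Tendsto (fun x : ℝ => c * √x) atTop atTop :=
    Real.tendsto_sqrt_atTop.const_mul_atTop hc
  have hl : Tendsto F atTop (𝓝 (c⁻¹ * (s - Real.exp (2 * r * c) * (-s)))) := by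
    have a1 : Tendsto (fun x : ℝ => c * √x - r * (√x)⁻¹) atTop atTop := by
      simpa [sub_eq_add_neg] using hct.atTop_add ((hinv.const_mul r).neg)
    have a2 : Tendsto (fun x : ℝ => -(c * √x + r * (√x)⁻¹)) atTop atBot :=
      tendsto_neg_atTop_atBot.comp (hct.atTop_add (hinv.const_mul r))
    exact ((auxPhi_top.comp a1).sub ((auxPhi_bot.comp a2).const_mul _)).const_mul _
  have hpos : ∀ x ∈ Ioi (0:ℝ), 0 ≤ (√x)⁻¹ * Real.exp (-(r - c * x) ^ 2 / (2 * x)) := by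
    intro x _
    positivity
  have hsq0 : Tendsto (fun x : ℝ => c * √x) (𝓝[>] 0) (𝓝 0) := by
    simpa using (hsq.mono_right nhdsWithin_le_nhds).const_mul c
  rcases hr.eq_or_lt with rfl | hr
  · have h0 : Tendsto F (𝓝[>] 0) (𝓝 0) := by
      have hph : Tendsto auxPhi (𝓝 0) (𝓝 0) := by
        have := (auxPhi_deriv 0).continuousAt.tendsto
        simpa [auxPhi] using this
      have b1 := hph.comp hsq0
      have b2 := hph.comp (by simpa using hsq0.neg : Tendsto (fun x : ℝ => -(c * √x)) (𝓝[>] 0) (𝓝 0))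
      have := (b1.sub b2).const_mul c⁻¹
      simpa [hF, Function.comp_def] using this
    obtain ⟨i1, i2⟩ := aux_improper F _ _ _ h0 hd hpos hl
    refine ⟨i1, ?_⟩
    rw [i2, mul_zero, zero_mul, Real.exp_zero]
    ring
  · have hi0 : Tendsto (fun x : ℝ => r * (√x)⁻¹) (𝓝[>] 0) atTop :=
      (tendsto_inv_nhdsGT_zero.comp hsq).const_mul_atTop hr
    have h0 : Tendsto F (𝓝[>] 0) (𝓝 (c⁻¹ * (-s - Real.exp (2 * r * c) * (-s)))) := by
      have a1 : Tendsto (fun x : ℝ => c * √x - r * (√x)⁻¹) (𝓝[>] 0) atBot := by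
        simpa [sub_eq_add_neg] using hsq0.add_atBot (tendsto_neg_atTop_atBot.comp hi0)
      have a2 : Tendsto (fun x : ℝ => -(c * √x + r * (√x)⁻¹)) (𝓝[>] 0) atBot :=
        tendsto_neg_atTop_atBot.comp (hsq0.add_atTop hi0)
      exact ((auxPhi_bot.comp a1).sub ((auxPhi_bot.comp a2).const_mul _)).const_mul _
    obtain ⟨i1, i2⟩ := aux_improper F _ _ _ h0 hd hpos hl
    refine ⟨i1, ?_⟩
    rw [i2]
    ring


open MeasureTheory Set Real

/-- Theorem 2(ii): if `g*(x) = x^{-(p-1)/2} g(x)` is nonincreasing on `(0, ∞)`, or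
`β = 0`, then the multivariate normal variance-mean mixture density `f` is maximized
at `μ`. -/
theorem multivariate_mixture_mode_at_mu
    (p : ℕ) (hp : 1 ≤ p)
    (μ β : Fin p → ℝ)
    (A : Matrix (Fin p) (Fin p) ℝ) (hA : IsUnit A.det)
    (g : ℝ → ℝ) (hg_meas : Measurable g) (hg_nonneg : ∀ x, 0 ≤ g x)
    (hg_supp : ∀ x ≤ 0, g x = 0)
    (hg_int : IntegrableOn g (Ioi 0))
    (hg_pos : 0 < ∫ x in Ioi (0:ℝ), g x)
    (f : (Fin p → ℝ) → ℝ)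
    (hf : ∀ y, f y = |A.det|⁻¹ * ∫ x in Ioi (0:ℝ),
      (2 * π * x) ^ (-(p:ℝ)/2) *
        Real.exp (-(∑ i, (A⁻¹.mulVec (y - μ - x • β) i) ^ 2) / (2 * x)) * g x)
    (hf_int : ∀ y, IntegrableOn (fun x =>
      (2 * π * x) ^ (-(p:ℝ)/2) *
        Real.exp (-(∑ i, (A⁻¹.mulVec (y - μ - x • β) i) ^ 2) / (2 * x)) * g x) (Ioi 0))
    (hg_dec : AntitoneOn (fun x => x ^ (-((p:ℝ) - 1)/2) * g x) (Ioi 0) ∨ β = 0) :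
    ∀ y, f y ≤ f μ := by
  intro y
  rw [hf y, hf μ]
  refine mul_le_mul_of_nonneg_left ?_ (by positivity)
  set u : Fin p → ℝ := A⁻¹.mulVec (y - μ) with hu
  set b : Fin p → ℝ := A⁻¹.mulVec β with hb
  set r := √(∑ i, u i ^ 2) with hr
  set c := √(∑ i, b i ^ 2) with hc
  set k := ∑ i, u i * b i with hk
  have hr0 : 0 ≤ r := Real.sqrt_nonneg _
  have hc0 : 0 ≤ c := Real.sqrt_nonneg _
  have hr2 : r ^ 2 = ∑ i, u i ^ 2 := Real.sq_sqrt (Finset.sum_nonneg fun i _ => sq_nonneg _)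
  have hc2 : c ^ 2 = ∑ i, b i ^ 2 := Real.sq_sqrt (Finset.sum_nonneg fun i _ => sq_nonneg _)
  have hkrc : k ≤ r * c := by
    have := Finset.sum_mul_sq_le_sq_mul_sq Finset.univ u b
    rw [← hr2, ← hc2, ← hk, ← mul_pow] at this
    exact (abs_le_of_sq_le_sq' this (by positivity)).2
  have hSy : ∀ x : ℝ, ∑ i, (A⁻¹.mulVec (y - μ - x • β) i) ^ 2
      = r ^ 2 - 2 * x * k + x ^ 2 * c ^ 2 := by
    intro x
    rw [hr2, hc2, hk, Finset.mul_sum, Finset.mul_sum, ← Finset.sum_sub_distrib,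
      ← Finset.sum_add_distrib]
    refine Finset.sum_congr rfl fun i _ => ?_
    rw [Matrix.mulVec_sub, Matrix.mulVec_smul]
    simp only [Pi.sub_apply, Pi.smul_apply, smul_eq_mul, ← hu, ← hb]
    ring
  have hSm : ∀ x : ℝ, ∑ i, (A⁻¹.mulVec (μ - μ - x • β) i) ^ 2 = x ^ 2 * c ^ 2 := by
    intro x
    rw [hc2, Finset.mul_sum]
    refine Finset.sum_congr rfl fun i _ => ?_
    rw [sub_self, zero_sub, Matrix.mulVec_neg, Matrix.mulVec_smul]
    simp only [Pi.neg_apply, Pi.smul_apply, smul_eq_mul, ← hb]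
    ring
  have hiy := hf_int y
  have him := hf_int μ
  simp only [hSy] at hiy ⊢
  simp only [hSm] at him ⊢
  have hexp : ∀ x : ℝ, 0 < x → Real.exp (-(r ^ 2 - 2 * x * k + x ^ 2 * c ^ 2) / (2 * x))
      ≤ Real.exp (-(r - c * x) ^ 2 / (2 * x)) := by
    intro x hx
    gcongr
    nlinarith
  by_cases hrc : r * c = 0
  · refine setIntegral_mono_on hiy him measurableSet_Ioi fun x hx => ?_
    have hx : 0 < x := hx
    have hgx := hg_nonneg x
    gcongr
    nlinarith [sq_nonneg r]
  have hrp : 0 < r := lt_of_le_of_ne hr0 fun h => hrc (by simp [← h])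
  have hcp : 0 < c := lt_of_le_of_ne hc0 fun h => hrc (by simp [← h])
  rcases hg_dec with hdec | hβ
  swap
  · exfalso
    apply hrc
    simp [hc, hb, hβ]
  obtain ⟨i1, v1⟩ := aux_phi_int r c hr0 hcp
  obtain ⟨i0, v0⟩ := aux_phi_int 0 c le_rfl hcp
  set x0 := r / (2 * c) with hx0
  have hx0p : 0 < x0 := by positivity
  set h : ℝ → ℝ := fun x => x ^ (-((p:ℝ) - 1)/2) * g x with hh
  set C : ℝ := (2 * π) ^ (-(p:ℝ)/2) with hC
  have hCp : 0 < C := by positivity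
  have hfac : ∀ x : ℝ, 0 < x → (2 * π * x) ^ (-(p:ℝ)/2) * g x = C * (√x)⁻¹ * h x := by
    intro x hx
    rw [Real.mul_rpow (by positivity) hx.le, hC, hh, Real.sqrt_eq_rpow, ← Real.rpow_neg hx.le]
    rw [show (-(p:ℝ)/2) = -(1/2) + (-((p:ℝ) - 1)/2) by ring, Real.rpow_add hx]
    ring
  have key : ∫ x in Ioi (0:ℝ), C * h x0 * ((√x)⁻¹ * Real.exp (-(0 - c * x) ^ 2 / (2 * x))
        - (√x)⁻¹ * Real.exp (-(r - c * x) ^ 2 / (2 * x)))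
      ≤ ∫ x in Ioi (0:ℝ), ((2 * π * x) ^ (-(p:ℝ)/2) * Real.exp (-(x ^ 2 * c ^ 2) / (2 * x)) * g x
        - (2 * π * x) ^ (-(p:ℝ)/2) *
          Real.exp (-(r ^ 2 - 2 * x * k + x ^ 2 * c ^ 2) / (2 * x)) * g x) := by
    refine setIntegral_mono_on ((i0.sub i1).const_mul _) (him.sub hiy) measurableSet_Ioi ?_
    intro x hx
    have hx : 0 < x := hx
    have hE := hexp x hx
    have hq : 0 < (√x)⁻¹ := inv_pos.2 (Real.sqrt_pos.2 hx)
    have hhx : 0 ≤ h x := mul_nonneg (Real.rpow_nonneg hx.le _) (hg_nonneg x)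
    have e0 : -(0 - c * x) ^ 2 / (2 * x) = -(x ^ 2 * c ^ 2) / (2 * x) := by ring
    rw [e0]
    set E0 := Real.exp (-(x ^ 2 * c ^ 2) / (2 * x)) with hE0
    set E1 := Real.exp (-(r - c * x) ^ 2 / (2 * x)) with hE1
    set Ey := Real.exp (-(r ^ 2 - 2 * x * k + x ^ 2 * c ^ 2) / (2 * x)) with hEy
    have e2 : (2 * π * x) ^ (-(p:ℝ)/2) * E0 * g x - (2 * π * x) ^ (-(p:ℝ)/2) * Ey * g x
        = C * (√x)⁻¹ * (h x * (E0 - Ey)) := by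
      linear_combination (E0 - Ey) * hfac x hx
    rw [e2]
    have e3 : C * h x0 * ((√x)⁻¹ * E0 - (√x)⁻¹ * E1) = C * (√x)⁻¹ * (h x0 * (E0 - E1)) := by ring
    rw [e3]
    refine mul_le_mul_of_nonneg_left ?_ (by positivity)
    have s1 : h x * (E0 - E1) ≤ h x * (E0 - Ey) :=
      mul_le_mul_of_nonneg_left (by linarith) hhx
    refine le_trans ?_ s1
    have hcx0 : 2 * c * x0 = r := by rw [hx0]; field_simp
    rcases le_total x x0 with hxx | hxx
    · have m := hdec (mem_Ioi.2 hx) (mem_Ioi.2 hx0p) hxx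
      refine mul_le_mul_of_nonneg_right m (sub_nonneg.2 ?_)
      rw [hE0, hE1]
      gcongr
      have : 2 * c * x ≤ r := by rw [← hcx0]; gcongr
      nlinarith
    · have m := hdec (mem_Ioi.2 hx0p) (mem_Ioi.2 hx) hxx
      refine mul_le_mul_of_nonpos_right m (sub_nonpos.2 ?_)
      rw [hE0, hE1]
      gcongr
      have : r ≤ 2 * c * x := by rw [← hcx0]; gcongr
      nlinarith
  rw [integral_const_mul, integral_sub i0 i1, v0, v1, sub_self, mul_zero,
    integral_sub him hiy] at key
  linarith
end

section
/- Let p ≥ 1, let μ, β be vectors in ℝ^p, let A be an invertible p×p real matrix, let g be a nonnegative measurable function supported on (0,∞) with 0 < ∫₀^∞ g(x) dx < ∞, and define f(y) = |det A|^{-1} ∫₀^∞ (2πx)^{-p/2} · exp(−‖A⁻¹(y − μ − xβ)‖²/(2x)) · g(x) dx for y ∈ ℝ^p, assumed finite everywhere. If the function g*(x) = x^{−(p−1)/2} g(x) is log-concave on (0,∞), then f is log-concave on ℝ^p. -/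
open MeasureTheory Set Real

noncomputable def KK (a b s x : ℝ) : ℝ :=
  (√(x * (s - x)))⁻¹ * Real.exp (-(a^2 / (2*x) + b^2 / (2*(s-x))))

noncomputable def PhiC (C s u : ℝ) : ℝ :=
  Real.exp (-(u^2 + C^2) / (2*s)) * (C / (u^2 + C^2))

lemma exists_tau {s x : ℝ} (hx : x ∈ Ioo 0 s) : ∃ t : ℝ, 0 < t ∧ t = √((s-x)/x) ∧
    x = s / (1 + t^2) := by
  obtain ⟨h0, h1⟩ := hx
  have : 0 < (s-x)/x := div_pos (by linarith) h0
  refine ⟨√((s-x)/x), Real.sqrt_pos.2 this, rfl, ?_⟩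
  rw [Real.sq_sqrt this.le]
  field_simp
  ring

lemma KK_tau {s t a b : ℝ} (hs : 0 < s) (ht : 0 < t) :
    KK a b s (s / (1 + t^2)) = (1+t^2)/(s*t) *
      Real.exp (-((a*t - b/t)^2 + (a+b)^2) / (2*s)) := by
  have h1 : 0 < 1 + t^2 := by positivity
  unfold KK
  have e1 : s / (1+t^2) * (s - s/(1+t^2)) = (s*t/(1+t^2))^2 := by
    field_simp; ring
  rw [e1, Real.sqrt_sq (by positivity)]
  have e2 : s - s/(1+t^2) = s*t^2/(1+t^2) := by field_simp; ring
  rw [e2, inv_div]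
  congr 2
  field_simp
  ring

lemma hasDeriv_tau {s x t : ℝ} (hs : 0 < s) (ht : 0 < t) (hx : x = s / (1 + t^2)) :
    HasDerivAt (fun x => √((s-x)/x)) (-((1+t^2)^2/(2*s*t))) x := by
  have h1 : 0 < 1 + t^2 := by positivity
  have hx0 : 0 < x := by rw [hx]; positivity
  have e : (s-x)/x = t^2 := by rw [hx]; field_simp; ring
  have := (((hasDerivAt_id x).const_sub s).div (hasDerivAt_id x) hx0.ne').sqrt
    (by simp only [id, Pi.div_apply]; rw [e]; positivity)
  simp only [id, Pi.div_apply] at this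
  rw [e, Real.sqrt_sq ht.le] at this
  convert this using 1
  rw [hx]
  field_simp
  ring

lemma tau_of {s t : ℝ} (hs : 0 < s) (ht : 0 < t) : √((s-s / (1 + t^2))/(s / (1 + t^2))) = t := by
  have h1 : 0 < 1 + t^2 := by positivity
  rw [show (s-s / (1 + t^2))/(s / (1 + t^2)) = t^2 by field_simp; ring, Real.sqrt_sq ht.le]

lemma mem_of_tau {s t : ℝ} (hs : 0 < s) (ht : 0 < t) : s / (1 + t^2) ∈ Ioo 0 s := by
  refine ⟨by positivity, ?_⟩
  rw [div_lt_iff₀ (by positivity)]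
  nlinarith [mul_pos hs (pow_pos ht 2)]

lemma PhiC_int {C s : ℝ} (hs : 0 < s) (hC : 0 < C) : Integrable (PhiC C s) := by
  have hI : Integrable (fun u : ℝ => C⁻¹ * Real.exp (-(1/(2*s)) * u^2)) :=
    (integrable_exp_neg_mul_sq (by positivity)).const_mul _
  refine hI.mono' ?_ ?_
  · have : Continuous (PhiC C s) := by
      unfold PhiC
      refine Continuous.mul (by fun_prop) (Continuous.div (by fun_prop) (by fun_prop) ?_)
      intro u; positivity
    exact this.aestronglyMeasurable
  · refine Filter.Eventually.of_forall fun u => ?_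
    unfold PhiC
    rw [Real.norm_of_nonneg (by positivity), mul_comm]
    gcongr
    · rw [div_le_iff₀ (by positivity)]
      have : C⁻¹ * C = 1 := by field_simp
      have h2 : 0 ≤ C⁻¹ * u^2 := by positivity
      nlinarith
    · rw [div_le_iff₀ (by positivity)]
      have : -(1/(2*s))*u^2*(2*s) = -u^2 := by field_simp
      rw [this]; nlinarith [sq_nonneg C]

noncomputable def WW (a b s x : ℝ) : ℝ := a*b*s/(a^2*(s-x)+b^2*x)

lemma WW_tau {s t a b : ℝ} (hs : 0 < s) (ht : 0 < t) (ha : 0 < a) (hb : 0 < b) :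
    WW a b s (s/(1+t^2)) = a*b*(1+t^2)/(a^2*t^2+b^2) := by
  unfold WW
  have h1 : 0 < 1 + t^2 := by positivity
  rw [show a^2*(s-s/(1+t^2))+b^2*(s/(1+t^2)) = s*(a^2*t^2+b^2)/(1+t^2) by field_simp; ring]
  field_simp

lemma cov1 {a b s : ℝ} (hs : 0 < s) (ha : 0 < a) (hb : 0 < b) :
    IntegrableOn (fun x => 1/2 * (KK a b s x * (1 + WW a b s x))) (Ioo 0 s) ∧
    ∫ x in Ioo 0 s, 1/2 * (KK a b s x * (1 + WW a b s x)) = ∫ u, PhiC (a+b) s u := by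
  set U : ℝ → ℝ := fun x => a * √((s-x)/x) - b / √((s-x)/x) with hU
  set U' : ℝ → ℝ := fun x => let t := √((s-x)/x); -((a + b/t^2) * ((1+t^2)^2/(2*s*t))) with hU'
  have hder : ∀ x ∈ Ioo 0 s, HasDerivWithinAt U (U' x) (Ioo 0 s) x := by
    intro x hx
    obtain ⟨t, ht, e, hxt⟩ := exists_tau hx
    have h := hasDeriv_tau hs ht hxt
    have h2 := (h.const_mul a).sub ((hasDerivAt_const x b).div h (by rw [← e]; exact ht.ne'))
    have h3 : HasDerivAt U _ x := h2
    refine HasDerivAt.hasDerivWithinAt ?_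
    refine h3.congr_deriv ?_
    simp only [hU', ← e]
    field_simp
    ring
  have hinj : InjOn U (Ioo 0 s) := by
    intro x hx y hy hxy
    obtain ⟨t, ht, e, hxt⟩ := exists_tau hx
    obtain ⟨r, hr, e', hyr⟩ := exists_tau hy
    simp only [hU, ← e, ← e'] at hxy
    have : t = r := by
      have h3 : (t - r) * (a + b/(t*r)) = 0 := by
        field_simp
        field_simp at hxy
        linarith
      rcases mul_eq_zero.1 h3 with h | h
      · linarith
      · have : 0 < a + b/(t*r) := by positivity
        linarith
    rw [hxt, hyr, this]
  have himg : U '' (Ioo 0 s) = univ := by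
    refine eq_univ_of_forall fun u => ?_
    set q := √(u^2+4*a*b)
    have hq : q^2 = u^2+4*a*b := Real.sq_sqrt (by positivity)
    have hq0 : 0 ≤ q := Real.sqrt_nonneg _
    have hqu : 0 < u + q := by
      have : 0 < a*b := by positivity
      have : |u| < q := by
        apply lt_of_pow_lt_pow_left₀ 2 hq0
        rw [sq_abs]; nlinarith
      have := neg_abs_le u
      linarith
    have ht : 0 < (u+q)/(2*a) := by positivity
    refine ⟨_, mem_of_tau hs ht, ?_⟩
    simp only [hU, tau_of hs ht]
    field_simp
    nlinarith
  have hpt : ∀ x ∈ Ioo 0 s, |U' x| • PhiC (a+b) s (U x) =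
      1/2 * (KK a b s x * (1 + WW a b s x)) := by
    intro x hx
    obtain ⟨t, ht, e, hxt⟩ := exists_tau hx
    have eK := KK_tau (a := a) (b := b) hs ht
    have eW := WW_tau hs ht ha hb
    rw [← hxt] at eK eW
    rw [eK, eW]
    simp only [hU, hU', ← e, PhiC, abs_neg, smul_eq_mul]
    rw [abs_of_pos (by positivity)]
    have : (a*t-b/t)^2+(a+b)^2 = (a^2*t^2+b^2)*(1+t^2)/t^2 := by field_simp; ring
    have h2 : (a + b / t ^ 2) * ((1 + t ^ 2) ^ 2 / (2 * s * t)) * ((a + b) / ((a * t - b / t) ^ 2 + (a + b) ^ 2)) = 1/2 * ((1 + t ^ 2) / (s * t) * (1 + a * b * (1 + t ^ 2) / (a ^ 2 * t ^ 2 + b ^ 2))) := by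
      rw [this]; field_simp; ring
    linear_combination (Real.exp (-((a * t - b / t) ^ 2 + (a + b) ^ 2) / (2 * s))) * h2
  have hi := integrableOn_image_iff_integrableOn_abs_deriv_smul measurableSet_Ioo hder hinj
    (PhiC (a+b) s)
  have he := integral_image_eq_integral_abs_deriv_smul measurableSet_Ioo hder hinj
    (PhiC (a+b) s)
  rw [himg] at hi he
  constructor
  · refine (hi.1 (PhiC_int hs (by positivity)).integrableOn).congr_fun hpt measurableSet_Ioo
  · rw [← setIntegral_congr_fun measurableSet_Ioo hpt, ← he, setIntegral_univ]

lemma KK_meas (a b s : ℝ) : Measurable (KK a b s) := by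
  unfold KK; fun_prop

lemma KK_nonneg (a b s x : ℝ) : 0 ≤ KK a b s x := by
  unfold KK; positivity

lemma cov2 {a b s : ℝ} (hs : 0 < s) (ha : 0 < a) (hb : 0 < b) :
    ∫ x in Ioo 0 s, KK a b s x = ∫ x in Ioo 0 s, KK a b s x * WW a b s x := by
  set V : ℝ → ℝ := fun x => s * a^2 * (s-x) / (a^2*(s-x)+b^2*x) with hV
  set V' : ℝ → ℝ := fun x => -(a^2*b^2*s^2 / (a^2*(s-x)+b^2*x)^2) with hV'
  have hD : ∀ x ∈ Ioo 0 s, 0 < a^2*(s-x)+b^2*x := by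
    intro x hx
    have h1 := hx.1
    have h2 : 0 < s - x := by linarith [hx.2]
    positivity
  have hder : ∀ x ∈ Ioo 0 s, HasDerivWithinAt V (V' x) (Ioo 0 s) x := by
    intro x hx
    have hd := hD x hx
    have h1 := ((hasDerivAt_id x).const_sub s).const_mul (s*a^2)
    have h2 := (((hasDerivAt_id x).const_sub s).const_mul (a^2)).add
      ((hasDerivAt_id x).const_mul (b^2))
    refine HasDerivAt.hasDerivWithinAt ?_
    have h3 : HasDerivAt V _ x := h1.div h2 hd.ne'
    refine h3.congr_deriv ?_
    simp only [hV', id]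
    field_simp
    ring
  have hVt : ∀ t, 0 < t → V (s/(1+t^2)) = s/(1+(b/(a*t))^2) := by
    intro t ht
    have h1 : 0 < 1 + t^2 := by positivity
    simp only [hV]
    rw [show a^2*(s-s/(1+t^2))+b^2*(s/(1+t^2)) = s*(a^2*t^2+b^2)/(1+t^2) by field_simp; ring]
    field_simp
    ring
  have hmem : ∀ x ∈ Ioo 0 s, V x ∈ Ioo 0 s := by
    intro x hx
    obtain ⟨t, ht, e, hxt⟩ := exists_tau hx
    rw [hxt, hVt t ht]
    exact mem_of_tau hs (by positivity)
  have hinv : ∀ x ∈ Ioo 0 s, V (V x) = x := by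
    intro x hx
    obtain ⟨t, ht, e, hxt⟩ := exists_tau hx
    rw [hxt, hVt t ht, hVt _ (by positivity)]
    congr 3
    field_simp
  have hinj : InjOn V (Ioo 0 s) := by
    intro x hx y hy hxy
    rw [← hinv x hx, hxy, hinv y hy]
  have himg : V '' (Ioo 0 s) = Ioo 0 s := by
    apply Subset.antisymm
    · rintro _ ⟨x, hx, rfl⟩; exact hmem x hx
    · intro x hx; exact ⟨V x, hmem x hx, hinv x hx⟩
  have he := integral_image_eq_integral_abs_deriv_smul measurableSet_Ioo hder hinj (KK a b s)
  rw [himg] at he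
  rw [he]
  refine setIntegral_congr_fun measurableSet_Ioo fun x hx => ?_
  obtain ⟨t, ht, e, hxt⟩ := exists_tau hx
  have h1 : 0 < 1 + t^2 := by positivity
  have eV' : V' x = -(a^2*b^2*(1+t^2)^2/(a^2*t^2+b^2)^2) := by
    simp only [hV', hxt]
    rw [show a^2*(s-s/(1+t^2))+b^2*(s/(1+t^2)) = s*(a^2*t^2+b^2)/(1+t^2) by field_simp; ring]
    field_simp
  rw [eV', hxt, hVt t ht, KK_tau hs ht, KK_tau hs (by positivity : 0 < b/(a*t)), WW_tau hs ht ha hb,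
    abs_neg, abs_of_pos (by positivity), smul_eq_mul]
  rw [show a * (b/(a*t)) - b/(b/(a*t)) = -(a*t - b/t) by field_simp; ring, neg_sq]
  have h2 : a ^ 2 * b ^ 2 * (1 + t ^ 2) ^ 2 / (a ^ 2 * t ^ 2 + b ^ 2) ^ 2 * ((1 + (b / (a * t)) ^ 2) / (s * (b / (a * t)))) = (1 + t ^ 2) / (s * t) * (a * b * (1 + t ^ 2) / (a ^ 2 * t ^ 2 + b ^ 2)) := by
    field_simp
  linear_combination (Real.exp (-((a * t - b / t) ^ 2 + (a + b) ^ 2) / (2 * s))) * h2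

lemma KK_int {a b s : ℝ} (hs : 0 < s) (ha : 0 < a) (hb : 0 < b) :
    IntegrableOn (KK a b s) (Ioo 0 s) ∧ ∫ x in Ioo 0 s, KK a b s x = ∫ u, PhiC (a+b) s u := by
  obtain ⟨h1, h2⟩ := cov1 hs ha hb
  have hW : ∀ x ∈ Ioo 0 s, 0 ≤ WW a b s x := by
    intro x hx
    have h1 := hx.1
    have h2 : 0 < s - x := by linarith [hx.2]
    unfold WW; positivity
  have hK : IntegrableOn (KK a b s) (Ioo 0 s) := by
    refine (h1.const_mul 2).mono' (KK_meas a b s).aestronglyMeasurable ?_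
    refine (ae_restrict_iff' measurableSet_Ioo).2 (Filter.Eventually.of_forall fun x hx => ?_)
    rw [Real.norm_of_nonneg (KK_nonneg _ _ _ _)]
    nlinarith [mul_nonneg (KK_nonneg a b s x) (hW x hx)]
  have hKW : IntegrableOn (fun x => KK a b s x * WW a b s x) (Ioo 0 s) := by
    have := (h1.const_mul 2).sub hK
    refine this.congr (Filter.Eventually.of_forall fun x => ?_)
    simp only [Pi.sub_apply]; ring
  refine ⟨hK, ?_⟩
  rw [← h2, integral_const_mul]
  have : ∫ x in Ioo 0 s, KK a b s x * (1 + WW a b s x) =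
      (∫ x in Ioo 0 s, KK a b s x) + ∫ x in Ioo 0 s, KK a b s x * WW a b s x := by
    rw [← integral_add hK hKW]; congr 1; ext x; ring
  rw [this, ← cov2 hs ha hb]; ring
lemma refl_cov (s : ℝ) (F : ℝ → ℝ) :
    (IntegrableOn F (Ioo 0 s) ↔ IntegrableOn (fun x => F (s - x)) (Ioo 0 s)) ∧
    ∫ x in Ioo 0 s, F x = ∫ x in Ioo 0 s, F (s - x) := by
  have hder : ∀ x ∈ Ioo 0 s, HasDerivWithinAt (fun x => s - x) (-1) (Ioo 0 s) x := by
    intro x hx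
    exact ((hasDerivAt_id x).const_sub s).hasDerivWithinAt
  have hinj : InjOn (fun x => s - x) (Ioo 0 s) := by
    intro x hx y hy hxy; simpa using hxy
  have himg : (fun x => s - x) '' (Ioo 0 s) = Ioo 0 s := by simp
  have hi := integrableOn_image_iff_integrableOn_abs_deriv_smul measurableSet_Ioo hder hinj F
  have he := integral_image_eq_integral_abs_deriv_smul measurableSet_Ioo hder hinj F
  rw [himg] at hi he
  simp only [abs_neg, abs_one, one_smul] at hi he
  exact ⟨hi, he⟩

lemma KK_refl (a b s x : ℝ) : KK a b s (s - x) = KK b a s x := by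
  unfold KK
  rw [show (s - x) * (s - (s - x)) = x * (s - x) by ring, sub_sub_cancel, add_comm]

lemma exp_jensen {p q p' q' l : ℝ} (hl : 1 ≤ l) (h : 2 ≤ Real.exp p + Real.exp q)
    (hp : l * p ≤ p') (hq : l * q ≤ q') : 2 ≤ Real.exp p' + Real.exp q' := by
  have h1 := @(convexOn_rpow hl).2 (Real.exp p) (mem_Ici.2 (Real.exp_nonneg p)) (Real.exp q)
    (mem_Ici.2 (Real.exp_nonneg q)) (1/2) (1/2) (by norm_num) (by norm_num) (by norm_num)
  simp only [smul_eq_mul] at h1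
  rw [← Real.exp_mul, ← Real.exp_mul] at h1
  have h2 : 1 ≤ (1/2 * Real.exp p + 1/2 * Real.exp q) ^ l :=
    Real.one_le_rpow (by linarith) (by linarith)
  have h3 : Real.exp (p*l) ≤ Real.exp p' := Real.exp_le_exp.2 (by linarith)
  have h4 : Real.exp (q*l) ≤ Real.exp q' := Real.exp_le_exp.2 (by linarith)
  linarith

lemma KK_pos {a b s x : ℝ} (hx : x ∈ Ioo 0 s) : 0 < KK a b s x := by
  have h1 := hx.1
  have h2 : 0 < s - x := by linarith [hx.2]
  unfold KK; positivity

lemma KK_ratio {c d s x : ℝ} (hx : x ∈ Ioo 0 s) :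
    KK (c-d) (c+d) s x = KK c c s x * Real.exp
      ((2*c*d*(s-2*x) - d^2*s)/(2*(x*(s-x)))) := by
  have h1 := hx.1
  have h2 : 0 < s - x := by linarith [hx.2]
  unfold KK
  rw [mul_assoc, ← Real.exp_add]
  congr 2
  field_simp
  ring

lemma KK_ratio' {c d s x : ℝ} (hx : x ∈ Ioo 0 s) :
    KK (c+d) (c-d) s x = KK c c s x * Real.exp
      ((-(2*c*d*(s-2*x)) - d^2*s)/(2*(x*(s-x)))) := by
  have := KK_ratio (c := c) (d := -d) hx
  rw [sub_neg_eq_add, ← sub_eq_add_neg] at this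
  rw [this]; congr 3; ring

lemma sign_aux {c d s x z : ℝ} (hx : x ∈ Ioo 0 s) (hz : z ∈ Ioo 0 s)
    (hz2 : 0 ≤ s - 2*z) (hxz : s - 2*z < s - 2*x)
    (h : 2 * KK c c s z < KK (c-d) (c+d) s z + KK (c+d) (c-d) s z) :
    2 * KK c c s x ≤ KK (c-d) (c+d) s x + KK (c+d) (c-d) s x := by
  have hx1 := hx.1
  have hx2 : 0 < s - x := by linarith [hx.2]
  have hz1 := hz.1
  have hz2' : 0 < s - z := by linarith [hz.2]
  have hs : 0 < s := by linarith
  have hxp : 0 < x*(s-x) := by positivity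
  have hzp : 0 < z*(s-z) := by positivity
  rw [KK_ratio hz, KK_ratio' hz] at h
  rw [KK_ratio hx, KK_ratio' hx]
  have kz : 0 < KK c c s z := KK_pos hz
  have kx : 0 < KK c c s x := KK_pos hx
  have h' : 2 < Real.exp ((2*c*d*(s-2*z) - d^2*s)/(2*(z*(s-z)))) +
      Real.exp ((-(2*c*d*(s-2*z)) - d^2*s)/(2*(z*(s-z)))) := by
    by_contra hcon
    push Not at hcon
    nlinarith
  suffices hh : 2 ≤ Real.exp ((2*c*d*(s-2*x) - d^2*s)/(2*(x*(s-x)))) +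
      Real.exp ((-(2*c*d*(s-2*x)) - d^2*s)/(2*(x*(s-x)))) by nlinarith
  have hz3 : 0 < s - 2*z := by
    rcases hz2.lt_or_eq with h3 | h3
    · exact h3
    · exfalso
      rw [← h3] at h'
      have : Real.exp ((-(d^2*s))/(2*(z*(s-z)))) ≤ 1 := by
        rw [Real.exp_le_one_iff]
        apply div_nonpos_of_nonpos_of_nonneg
        · have : 0 ≤ d^2*s := by positivity
          linarith
        · positivity
      simp only [mul_zero, zero_sub, neg_zero] at h'
      linarith
  have hprod : x*(s-x) ≤ z*(s-z) := by nlinarith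
  have key : d^2*s/(2*(x*(s-x))) ≤ ((s-2*x)*(z*(s-z))/((s-2*z)*(x*(s-x)))) * (d^2*s/(2*(z*(s-z)))) := by
    rw [show ((s-2*x)*(z*(s-z))/((s-2*z)*(x*(s-x)))) * (d^2*s/(2*(z*(s-z)))) =
      ((s-2*x)/(s-2*z)) * (d^2*s/(2*(x*(s-x)))) by field_simp]
    have : 1 ≤ (s-2*x)/(s-2*z) := by rw [le_div_iff₀ hz3]; linarith
    have h0 : 0 ≤ d^2*s/(2*(x*(s-x))) := by positivity
    nlinarith
  have key2 : ((s-2*x)*(z*(s-z))/((s-2*z)*(x*(s-x)))) * (2*c*d*(s-2*z)/(2*(z*(s-z)))) =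
      2*c*d*(s-2*x)/(2*(x*(s-x))) := by field_simp
  refine exp_jensen (l := (s-2*x)*(z*(s-z))/((s-2*z)*(x*(s-x)))) ?_ h'.le ?_ ?_
  · rw [le_div_iff₀ (by positivity), one_mul]
    exact mul_le_mul hxz.le hprod hxp.le (by linarith)
  · rw [sub_div, sub_div, mul_sub, key2]; linarith
  · rw [sub_div, sub_div, mul_sub, neg_div, neg_div, mul_neg, key2]; linarith

lemma sign_lem {c d s x z : ℝ} (hx : x ∈ Ioo 0 s) (hz : z ∈ Ioo 0 s)
    (hxz : (2*z-s)^2 < (2*x-s)^2)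
    (h : 2 * KK c c s z < KK (c-d) (c+d) s z + KK (c+d) (c-d) s z) :
    2 * KK c c s x ≤ KK (c-d) (c+d) s x + KK (c+d) (c-d) s x := by
  wlog hx2 : 0 ≤ s - 2*x generalizing x
  · have := @this (s-x) ⟨by linarith [hx.2], by linarith [hx.1]⟩ (by nlinarith) (by linarith)
    simp only [KK_refl] at this
    linarith
  wlog hz2 : 0 ≤ s - 2*z generalizing z
  · refine @this (s-z) ⟨by linarith [hz.2], by linarith [hz.1]⟩ ?_ (by nlinarith) (by linarith)
    simp only [KK_refl]
    linarith
  refine sign_aux hx hz hz2 ?_ h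
  apply lt_of_pow_lt_pow_left₀ 2 hx2
  nlinarith

lemma int3 {m : Measure ℝ} {f g h : ℝ → ℝ} (hf : Integrable f m) (hg : Integrable g m)
    (hh : Integrable h m) : ∫ x, (2 * f x - g x - h x) ∂m =
      2 * (∫ x, f x ∂m) - (∫ x, g x ∂m) - ∫ x, h x ∂m := by
  have h1 : Integrable (fun x => 2 * f x) m := hf.const_mul 2
  have h2 : Integrable (fun x => 2 * f x - g x) m := h1.sub hg
  rw [integral_sub h2 hh, integral_sub h1 hg, integral_const_mul]

lemma fiber {c d s : ℝ} (hs : 0 < s) (h1 : 0 < c - d) (h2 : 0 < c + d) (ψ : ℝ → ℝ)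
    (hψ0 : ∀ x, 0 ≤ ψ x) (hψs : ∀ x, ψ (s - x) = ψ x)
    (hψ : ∀ x ∈ Ioo 0 s, ∀ z ∈ Ioo 0 s, (2*z-s)^2 ≤ (2*x-s)^2 → ψ x ≤ ψ z)
    (i1 : IntegrableOn (fun x => KK (c-d) (c+d) s x * ψ x) (Ioo 0 s))
    (i2 : IntegrableOn (fun x => KK c c s x * ψ x) (Ioo 0 s)) :
    ∫ x in Ioo 0 s, KK (c-d) (c+d) s x * ψ x ≤ ∫ x in Ioo 0 s, KK c c s x * ψ x := by
  have hc : 0 < c := by linarith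
  obtain ⟨r1, r2⟩ := refl_cov s (fun x => KK (c-d) (c+d) s x * ψ x)
  simp only [KK_refl, hψs] at r1 r2
  have i3 := r1.1 i1
  obtain ⟨k1, e1⟩ := KK_int hs h1 h2
  obtain ⟨k2, e2⟩ := KK_int hs h2 h1
  obtain ⟨k3, e3⟩ := KK_int hs hc hc
  rw [show c - d + (c + d) = c + c by ring] at e1
  rw [show c + d + (c - d) = c + c by ring] at e2
  set D : ℝ → ℝ := fun x => 2 * KK c c s x - KK (c-d) (c+d) s x - KK (c+d) (c-d) s x with hD
  obtain ⟨m, hm⟩ : ∃ m : ℝ, ∀ x ∈ Ioo 0 s, m * D x ≤ ψ x * D x := by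
    by_cases hN : ∃ z ∈ Ioo 0 s, D z < 0
    · obtain ⟨z0, hz0, hz0D⟩ := hN
      have hbd : BddAbove (ψ '' {z | z ∈ Ioo 0 s ∧ D z < 0}) := by
        refine ⟨ψ (s/2), ?_⟩
        rintro _ ⟨z, ⟨hz, -⟩, rfl⟩
        apply hψ z hz (s/2) ⟨by linarith, by linarith⟩
        nlinarith [sq_nonneg (2*z-s)]
      refine ⟨sSup (ψ '' {z | z ∈ Ioo 0 s ∧ D z < 0}), fun x hx => ?_⟩
      rcases lt_or_ge (D x) 0 with hx0 | hx0
      · exact mul_le_mul_of_nonpos_right (le_csSup hbd ⟨x, ⟨hx, hx0⟩, rfl⟩) hx0.le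
      · rcases hx0.lt_or_eq with hx0 | hx0
        · refine mul_le_mul_of_nonneg_right (csSup_le ⟨_, z0, ⟨hz0, hz0D⟩, rfl⟩ ?_) hx0.le
          rintro _ ⟨z, ⟨hz, hzD⟩, rfl⟩
          apply hψ z hz x hx
          by_contra hcon
          push Not at hcon
          have := sign_lem (c := c) (d := d) hx hz hcon (by simp only [hD] at hzD; linarith)
          simp only [hD] at hx0; linarith
        · rw [← hx0]; simp
    · push Not at hN
      exact ⟨0, fun x hx => by rw [zero_mul]; exact mul_nonneg (hψ0 x) (hN x hx)⟩
  have iD : IntegrableOn D (Ioo 0 s) := ((k3.const_mul 2).sub k1).sub k2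
  have eD : ∫ x in Ioo 0 s, D x = 0 := by
    simp only [hD]
    rw [int3 k3 k1 k2, e1, e2, e3]; ring
  have hDψ : ∀ x, ψ x * D x = 2 * (KK c c s x * ψ x) - KK (c-d) (c+d) s x * ψ x
      - KK (c+d) (c-d) s x * ψ x := by intro x; simp only [hD]; ring
  have iDψ : IntegrableOn (fun x => ψ x * D x) (Ioo 0 s) := by
    simp only [hDψ]
    exact ((i2.const_mul 2).sub i1).sub i3
  have eDψ : ∫ x in Ioo 0 s, ψ x * D x = 2 * (∫ x in Ioo 0 s, KK c c s x * ψ x)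
     - (∫ x in Ioo 0 s, KK (c-d) (c+d) s x * ψ x) - ∫ x in Ioo 0 s, KK (c+d) (c-d) s x * ψ x := by
    simp only [hDψ]
    exact int3 i2 i1 i3
  have := setIntegral_mono_on (iD.const_mul m) iDψ measurableSet_Ioo hm
  rw [integral_const_mul, eD, eDψ, ← r2] at this
  linarith
noncomputable def qq (h : ℝ → ℝ) (r x : ℝ) : ℝ := (√x)⁻¹ * Real.exp (-(r^2/(2*x))) * h x

noncomputable def FF (h : ℝ → ℝ) (r : ℝ) : ℝ := ∫ x in Ioi (0:ℝ), qq h r x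

lemma qq_meas {h : ℝ → ℝ} (hm : Measurable h) (r : ℝ) : Measurable (qq h r) := by
  unfold qq; fun_prop

lemma qq_nonneg {h : ℝ → ℝ} (h0 : ∀ x, 0 ≤ h x) (r x : ℝ) : 0 ≤ qq h r x := by
  have := h0 x
  unfold qq; positivity

lemma qq_anti {h : ℝ → ℝ} (h0 : ∀ x, 0 ≤ h x) {r r' x : ℝ} (hr : 0 ≤ r) (hrr : r ≤ r')
    (hx : 0 < x) : qq h r' x ≤ qq h r x := by
  have := h0 x
  unfold qq
  gcongr

lemma qq_int {h : ℝ → ℝ} (hm : Measurable h) (h0 : ∀ x, 0 ≤ h x)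
    (hi : IntegrableOn (qq h 0) (Ioi 0)) (r : ℝ) : IntegrableOn (qq h r) (Ioi 0) := by
  refine hi.mono' (qq_meas hm r).aestronglyMeasurable ?_
  refine (ae_restrict_iff' measurableSet_Ioi).2 (Filter.Eventually.of_forall fun x hx => ?_)
  rw [Real.norm_of_nonneg (qq_nonneg h0 r x)]
  have := qq_anti h0 le_rfl (abs_nonneg r) hx
  unfold qq at this ⊢
  rwa [sq_abs] at this

lemma FF_anti {h : ℝ → ℝ} (hm : Measurable h) (h0 : ∀ x, 0 ≤ h x)
    (hi : IntegrableOn (qq h 0) (Ioi 0)) {r r' : ℝ} (hr : 0 ≤ r) (hrr : r ≤ r') :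
    FF h r' ≤ FF h r :=
  setIntegral_mono_on (qq_int hm h0 hi r') (qq_int hm h0 hi r) measurableSet_Ioi
    fun _ hx => qq_anti h0 hr hrr hx

lemma FF_cont {h : ℝ → ℝ} (hm : Measurable h) (h0 : ∀ x, 0 ≤ h x)
    (hi : IntegrableOn (qq h 0) (Ioi 0)) : Continuous (FF h) := by
  unfold FF
  refine continuous_of_dominated (bound := qq h 0) (fun r => (qq_meas hm r).aestronglyMeasurable)
    ?_ hi ?_
  · intro r
    refine (ae_restrict_iff' measurableSet_Ioi).2 (Filter.Eventually.of_forall fun x hx => ?_)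
    rw [Real.norm_of_nonneg (qq_nonneg h0 r x)]
    have := qq_anti h0 le_rfl (abs_nonneg r) hx
    unfold qq at this ⊢
    rwa [sq_abs] at this
  · refine Filter.Eventually.of_forall fun x => ?_
    unfold qq
    fun_prop

lemma FF_pos {h : ℝ → ℝ} (hm : Measurable h) (h0 : ∀ x, 0 ≤ h x)
    (hi : IntegrableOn (qq h 0) (Ioi 0))
    (hne : ¬ (h =ᵐ[volume.restrict (Ioi 0)] 0)) (r : ℝ) : 0 < FF h r := by
  refine lt_of_le_of_ne (integral_nonneg (qq_nonneg h0 r)) fun hcon => hne ?_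
  have h1 := (integral_eq_zero_iff_of_nonneg (qq_nonneg h0 r) (qq_int hm h0 hi r)).1 hcon.symm
  filter_upwards [h1, ae_restrict_mem measurableSet_Ioi] with x hx hx0
  have hx0' : 0 < x := hx0
  simp only [qq, Pi.zero_apply] at hx ⊢
  have : 0 < (√x)⁻¹ * Real.exp (-(r^2/(2*x))) := by positivity
  rcases mul_eq_zero.1 hx with h3 | h3
  · exact absurd h3 this.ne'
  · exact h3

lemma qq_conv (h : ℝ → ℝ) (a b s t : ℝ) :
    (Ioi (0:ℝ)).indicator (qq h a) t * (Ioi (0:ℝ)).indicator (qq h b) (s - t) =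
    (Ioo 0 s).indicator (fun t => KK a b s t * (h t * h (s - t))) t := by
  by_cases ht : t ∈ Ioo 0 s
  · have h1 : t ∈ Ioi (0:ℝ) := ht.1
    have h2 : s - t ∈ Ioi (0:ℝ) := by simp only [mem_Ioi]; linarith [ht.2]
    rw [indicator_of_mem ht, indicator_of_mem h1, indicator_of_mem h2]
    unfold qq KK
    rw [Real.sqrt_mul (le_of_lt h1), neg_add, Real.exp_add, mul_inv]
    ring
  · rw [indicator_of_notMem ht]
    by_cases h1 : t ∈ Ioi (0:ℝ)
    · have h2 : s - t ∉ Ioi (0:ℝ) := by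
        intro h2
        exact ht ⟨h1, by simp only [mem_Ioi] at h2; linarith⟩
      rw [indicator_of_notMem h2, mul_zero]
    · rw [indicator_of_notMem h1, zero_mul]

lemma FF_mid {h : ℝ → ℝ} (hm : Measurable h) (h0 : ∀ x, 0 ≤ h x)
    (hi : IntegrableOn (qq h 0) (Ioi 0))
    (hlc : ∀ s, ∀ x ∈ Ioo 0 s, ∀ z ∈ Ioo 0 s, (2*z-s)^2 ≤ (2*x-s)^2 →
      h x * h (s - x) ≤ h z * h (s - z))
    {c d : ℝ} (h1 : 0 < c - d) (h2 : 0 < c + d) :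
    FF h (c-d) * FF h (c+d) ≤ FF h c * FF h c := by
  have hI : ∀ r, Integrable ((Ioi (0:ℝ)).indicator (qq h r)) := fun r =>
    (integrable_indicator_iff measurableSet_Ioi).2 (qq_int hm h0 hi r)
  have hF : ∀ a b, FF h a * FF h b = ∫ s, (convolution ((Ioi (0:ℝ)).indicator (qq h a))
      ((Ioi (0:ℝ)).indicator (qq h b)) (ContinuousLinearMap.mul ℝ ℝ) volume) s := by
    intro a b
    rw [integral_convolution _ (hI a) (hI b), integral_indicator measurableSet_Ioi,
      integral_indicator measurableSet_Ioi]
    rfl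
  rw [hF, hF]
  refine integral_mono_ae ((hI _).integrable_convolution _ (hI _))
    ((hI _).integrable_convolution _ (hI _)) ?_
  filter_upwards [(hI (c-d)).ae_convolution_exists (ContinuousLinearMap.mul ℝ ℝ) (hI (c+d)),
    (hI c).ae_convolution_exists (ContinuousLinearMap.mul ℝ ℝ) (hI c)] with s e1 e2
  simp only [ConvolutionExistsAt, ContinuousLinearMap.mul_apply', qq_conv] at e1 e2
  rw [integrable_indicator_iff measurableSet_Ioo] at e1 e2
  simp only [convolution, ContinuousLinearMap.mul_apply', qq_conv]
  rw [integral_indicator measurableSet_Ioo, integral_indicator measurableSet_Ioo]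
  rcases le_or_gt s 0 with hs | hs
  · simp [Ioo_eq_empty (not_lt.2 hs)]
  · exact fiber hs h1 h2 (fun t => h t * h (s - t)) (fun x => mul_nonneg (h0 _) (h0 _))
      (fun x => by simp only [sub_sub_cancel]; ring) (hlc s) e1 e2

lemma mid_nonneg {ψ : ℝ → ℝ} (hc : Continuous ψ) (h0 : ψ 0 = 0) (h1 : ψ 1 = 0)
    (hmid : ∀ t δ, 0 ≤ t - δ → t + δ ≤ 1 → 0 ≤ δ → ψ (t - δ) + ψ (t + δ) ≤ 2 * ψ t)
    {t : ℝ} (ht : t ∈ Icc (0:ℝ) 1) : 0 ≤ ψ t := by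
  obtain ⟨m, hm, hmin⟩ := isCompact_Icc.exists_isMinOn (nonempty_Icc.2 zero_le_one)
    hc.continuousOn (s := Icc (0:ℝ) 1)
  have hmin' : ∀ x ∈ Icc (0:ℝ) 1, ψ m ≤ ψ x := fun x hx => hmin hx
  by_contra hcon
  push Not at hcon
  have hneg : ψ m < 0 := lt_of_le_of_lt (hmin' t ht) hcon
  have hcomp : IsCompact (Icc (0:ℝ) 1 ∩ ψ ⁻¹' {ψ m}) :=
    isCompact_Icc.inter_right (isClosed_singleton.preimage hc)
  obtain ⟨t0, ⟨ht0, ht0m⟩, hleast⟩ := hcomp.exists_isLeast ⟨m, hm, rfl⟩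
  have ht0m' : ψ t0 = ψ m := ht0m
  have hp : 0 < t0 := by
    rcases ht0.1.lt_or_eq with h | h
    · exact h
    · rw [← h, h0] at ht0m'; linarith
  have hq : t0 < 1 := by
    rcases ht0.2.lt_or_eq with h | h
    · exact h
    · rw [h, h1] at ht0m'; linarith
  set δ := min t0 (1 - t0)
  have hδ : 0 < δ := lt_min hp (by linarith)
  have hδ1 : δ ≤ t0 := min_le_left _ _
  have hδ2 : δ ≤ 1 - t0 := min_le_right _ _
  have := hmid t0 δ (by linarith) (by linarith) hδ.le
  have a1 := hmin' (t0 - δ) ⟨by linarith, by linarith⟩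
  have a2 := hmin' (t0 + δ) ⟨by linarith, by linarith⟩
  have a3 : ψ (t0 - δ) = ψ m := by linarith
  have := hleast ⟨⟨by linarith, by linarith⟩, a3⟩
  linarith

lemma log_concave_of_mid {L : ℝ → ℝ} (hc : Continuous L)
    (hmid : ∀ c d, 0 < c - d → 0 < c + d → L (c - d) + L (c + d) ≤ 2 * L c)
    {x y t : ℝ} (hx : 0 ≤ x) (hy : 0 ≤ y) (ht : t ∈ Icc (0:ℝ) 1) :
    t * L x + (1 - t) * L y ≤ L (t * x + (1 - t) * y) := by
  have hmid' : ∀ c d, 0 ≤ c - d → 0 ≤ c + d → L (c - d) + L (c + d) ≤ 2 * L c := by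
    intro c d h1 h2
    have t1 : Filter.Tendsto (fun e : ℝ => L (c + e - d) + L (c + e + d)) (nhdsWithin 0 (Ioi 0))
        (nhds (L (c - d) + L (c + d))) := by
      have : Continuous (fun e : ℝ => L (c + e - d) + L (c + e + d)) := by fun_prop
      have := (this.tendsto 0).mono_left (nhdsWithin_le_nhds (s := Ioi 0))
      simpa using this
    have t2 : Filter.Tendsto (fun e : ℝ => 2 * L (c + e)) (nhdsWithin 0 (Ioi 0))
        (nhds (2 * L c)) := by
      have : Continuous (fun e : ℝ => 2 * L (c + e)) := by fun_prop
      have := (this.tendsto 0).mono_left (nhdsWithin_le_nhds (s := Ioi 0))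
      simpa using this
    refine le_of_tendsto_of_tendsto t1 t2 ?_
    filter_upwards [self_mem_nhdsWithin] with e he
    have he' : 0 < e := he
    exact hmid _ _ (by linarith) (by linarith)
  have := mid_nonneg (ψ := fun t => L (t * x + (1 - t) * y) - (t * L x + (1 - t) * L y))
    (by fun_prop) (by simp) (by simp) ?_ ht
  · simpa using this
  · intro t δ h1 h2 h3
    have hnn : ∀ u, 0 ≤ u → u ≤ 1 → 0 ≤ u * x + (1 - u) * y := fun u hu hu' =>
      add_nonneg (mul_nonneg hu hx) (mul_nonneg (by linarith) hy)
    have e1 : (t - δ) * x + (1 - (t - δ)) * y = (t*x+(1-t)*y) - δ*(x-y) := by ring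
    have e2 : (t + δ) * x + (1 - (t + δ)) * y = (t*x+(1-t)*y) + δ*(x-y) := by ring
    have b1 := hnn (t-δ) h1 (by linarith)
    have b2 := hnn (t+δ) (by linarith) h2
    have := hmid' (t*x+(1-t)*y) (δ*(x-y)) (by rw [← e1]; exact b1) (by rw [← e2]; exact b2)
    simp only [e1, e2]
    linarith

lemma FF_concave {h : ℝ → ℝ} (hm : Measurable h) (h0 : ∀ x, 0 ≤ h x)
    (hi : IntegrableOn (qq h 0) (Ioi 0))
    (hne : ¬ (h =ᵐ[volume.restrict (Ioi 0)] 0))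
    (hlc : ∀ s, ∀ x ∈ Ioo 0 s, ∀ z ∈ Ioo 0 s, (2*z-s)^2 ≤ (2*x-s)^2 →
      h x * h (s - x) ≤ h z * h (s - z))
    {x y t : ℝ} (hx : 0 ≤ x) (hy : 0 ≤ y) (ht : t ∈ Icc (0:ℝ) 1) :
    t * Real.log (FF h x) + (1 - t) * Real.log (FF h y) ≤
      Real.log (FF h (t * x + (1 - t) * y)) := by
  have hp := FF_pos hm h0 hi hne
  refine log_concave_of_mid (L := fun r => Real.log (FF h r))
    ((FF_cont hm h0 hi).log fun r => (hp r).ne') ?_ hx hy ht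
  intro c d h1 h2
  have := Real.log_le_log (mul_pos (hp _) (hp _)) (FF_mid hm h0 hi hlc h1 h2)
  rw [Real.log_mul (hp _).ne' (hp _).ne', Real.log_mul (hp _).ne' (hp _).ne'] at this
  linarith

lemma lc_prod {G : ℝ → ℝ} (h0 : ∀ x, 0 ≤ G x)
    (hlc : ∀ x₁ ∈ Ioi (0:ℝ), ∀ x₂ ∈ Ioi (0:ℝ), ∀ θ ∈ Ioo (0:ℝ) 1,
      G x₁ ^ θ * G x₂ ^ (1 - θ) ≤ G (θ * x₁ + (1 - θ) * x₂))
    {s x z : ℝ} (hx : x ∈ Ioo 0 s) (hz : z ∈ Ioo 0 s) (hxz : (2*z-s)^2 ≤ (2*x-s)^2) :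
    G x * G (s - x) ≤ G z * G (s - z) := by
  wlog hx2 : 0 ≤ s - 2*x generalizing x
  · have := @this (s-x) ⟨by linarith [hx.2], by linarith [hx.1]⟩ (by nlinarith) (by linarith)
    rw [sub_sub_cancel] at this
    linarith
  have hab : |2*z-s| ≤ s-2*x := by
    apply abs_le_of_sq_le_sq _ hx2
    nlinarith
  obtain ⟨l1, l2⟩ := abs_le.1 hab
  rcases eq_or_lt_of_le l1 with l1 | l1
  · have : z = x := by linarith
    rw [this]
  rcases eq_or_lt_of_le l2 with l2 | l2
  · have : z = s - x := by linarith
    rw [this, sub_sub_cancel, mul_comm]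
  have hpos : 0 < s - 2*x := by linarith
  set θ := (s - x - z)/(s-2*x) with hθ
  have hθ0 : 0 < θ := div_pos (by linarith) hpos
  have hθ1 : θ < 1 := by rw [hθ, div_lt_one hpos]; linarith
  have hθe : θ * (s-2*x) = s - x - z := div_mul_cancel₀ _ hpos.ne'
  have hx' : s - x ∈ Ioi (0:ℝ) := by simp only [mem_Ioi]; linarith [hx.2]
  have m1 := hlc x hx.1 (s-x) hx' θ ⟨hθ0, hθ1⟩
  have m2 := hlc x hx.1 (s-x) hx' (1-θ) ⟨by linarith, by linarith⟩
  rw [show θ * x + (1-θ)*(s-x) = z by linarith] at m1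
  rw [show (1-θ) * x + (1-(1-θ))*(s-x) = s - z by linarith] at m2
  rw [sub_sub_cancel] at m2
  have m3 := mul_le_mul m1 m2 (mul_nonneg (Real.rpow_nonneg (h0 _) _) (Real.rpow_nonneg (h0 _) _)) (h0 _)
  have r : ∀ u, G u ^ θ * G u ^ (1-θ) = G u := by
    intro u
    rw [← Real.rpow_add_of_nonneg (h0 u) hθ0.le (by linarith)]
    simp
  calc G x * G (s-x) = (G x ^ θ * G x ^ (1-θ)) * (G (s-x) ^ θ * G (s-x) ^ (1-θ)) := by rw [r, r]
    _ = _ := by ring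
    _ ≤ _ := m3

lemma integrand_eq {p : ℕ} (z b : Fin p → ℝ) (gx x : ℝ) (hx : 0 < x) :
    (2 * π * x) ^ (-(p:ℝ)/2) * Real.exp (-(∑ i, (z i - x * b i) ^ 2) / (2 * x)) * gx =
    ((2 * π) ^ (-(p:ℝ)/2) * Real.exp (∑ i, z i * b i)) *
      ((√x)⁻¹ * Real.exp (-((∑ i, z i ^ 2)/(2*x))) *
        (x ^ (-((p:ℝ) - 1)/2) * gx * Real.exp (-((∑ i, b i ^ 2)/2) * x))) := by
  have e1 : ∑ i, (z i - x * b i) ^ 2 = (∑ i, z i ^ 2) - 2 * x * (∑ i, z i * b i)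
      + x^2 * ∑ i, b i ^ 2 := by
    rw [Finset.mul_sum, Finset.mul_sum, ← Finset.sum_sub_distrib, ← Finset.sum_add_distrib]
    refine Finset.sum_congr rfl fun i _ => ?_
    ring
  have e2 : -(∑ i, (z i - x * b i) ^ 2) / (2 * x) = (∑ i, z i * b i) +
      (-((∑ i, z i ^ 2)/(2*x))) + (-((∑ i, b i ^ 2)/2) * x) := by
    rw [e1]; field_simp; ring
  have e3 : (2 * π * x) ^ (-(p:ℝ)/2) = (2*π) ^ (-(p:ℝ)/2) * ((√x)⁻¹ * x ^ (-((p:ℝ) - 1)/2)) := by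
    rw [Real.mul_rpow (by positivity) hx.le, Real.sqrt_eq_rpow, ← Real.rpow_neg hx.le,
      ← Real.rpow_add hx]
    congr 2; ring
  rw [e2, e3, Real.exp_add, Real.exp_add]
  ring

theorem multivariate_mixture_logConcave
    (p : ℕ) (hp : 1 ≤ p)
    (μ β : Fin p → ℝ)
    (A : Matrix (Fin p) (Fin p) ℝ) (hA : IsUnit A.det)
    (g : ℝ → ℝ) (hg_meas : Measurable g) (hg_nonneg : ∀ x, 0 ≤ g x)
    (hg_supp : ∀ x ≤ 0, g x = 0)
    (hg_int : IntegrableOn g (Ioi 0))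
    (hg_pos : 0 < ∫ x in Ioi (0:ℝ), g x)
    (f : (Fin p → ℝ) → ℝ)
    (hf : ∀ y, f y = |A.det|⁻¹ * ∫ x in Ioi (0:ℝ),
      (2 * π * x) ^ (-(p:ℝ)/2) *
        Real.exp (-(∑ i, (A⁻¹.mulVec (y - μ - x • β) i) ^ 2) / (2 * x)) * g x)
    (hf_int : ∀ y, IntegrableOn (fun x =>
      (2 * π * x) ^ (-(p:ℝ)/2) *
        Real.exp (-(∑ i, (A⁻¹.mulVec (y - μ - x • β) i) ^ 2) / (2 * x)) * g x) (Ioi 0))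
    (hg_lc : ∀ x₁ ∈ Ioi (0:ℝ), ∀ x₂ ∈ Ioi (0:ℝ), ∀ θ ∈ Ioo (0:ℝ) 1,
      (x₁ ^ (-((p:ℝ) - 1)/2) * g x₁) ^ θ * (x₂ ^ (-((p:ℝ) - 1)/2) * g x₂) ^ (1 - θ) ≤
        (θ * x₁ + (1 - θ) * x₂) ^ (-((p:ℝ) - 1)/2) * g (θ * x₁ + (1 - θ) * x₂)) :
    ∀ y₁ y₂ : Fin p → ℝ, ∀ θ ∈ Ioo (0:ℝ) 1,
      f y₁ ^ θ * f y₂ ^ (1 - θ) ≤ f (θ • y₁ + (1 - θ) • y₂) := by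
  set b : Fin p → ℝ := A⁻¹.mulVec β with hb
  set Zf : (Fin p → ℝ) → Fin p → ℝ := fun y => A⁻¹.mulVec (y - μ) with hZ
  set N : (Fin p → ℝ) → ℝ := fun z => ‖(WithLp.toLp 2 z : EuclideanSpace ℝ (Fin p))‖ with hN
  have hNsq : ∀ z, N z ^ 2 = ∑ i, z i ^ 2 := by
    intro z
    simp only [hN, EuclideanSpace.real_norm_sq_eq]
  set G : ℝ → ℝ := fun x => x ^ (-((p:ℝ) - 1)/2) * g x with hG
  set h : ℝ → ℝ := fun x => G x * Real.exp (-((∑ i, b i ^ 2)/2) * x) with hh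
  have hG0 : ∀ x, 0 ≤ G x := by
    intro x
    rcases le_or_gt x 0 with hx | hx
    · simp [hG, hg_supp x hx]
    · exact mul_nonneg (Real.rpow_nonneg hx.le _) (hg_nonneg x)
  have h0 : ∀ x, 0 ≤ h x := fun x => mul_nonneg (hG0 x) (Real.exp_nonneg _)
  have hm : Measurable h := by simp only [hh, hG]; fun_prop
  have hint : ∀ y, ∀ x ∈ Ioi (0:ℝ), (2 * π * x) ^ (-(p:ℝ)/2) *
        Real.exp (-(∑ i, (A⁻¹.mulVec (y - μ - x • β) i) ^ 2) / (2 * x)) * g x =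
      ((2 * π) ^ (-(p:ℝ)/2) * Real.exp (∑ i, Zf y i * b i)) * qq h (N (Zf y)) x := by
    intro y x hx
    have := integrand_eq (Zf y) b (g x) x hx
    unfold qq
    rw [hNsq]
    simp only [hh, hG]
    rw [← this]
    simp only [Matrix.mulVec_sub, Matrix.mulVec_smul, hZ, hb, Pi.sub_apply, Pi.smul_apply,
      smul_eq_mul]
  have hi : IntegrableOn (qq h 0) (Ioi 0) := by
    have h1 := (hf_int μ).congr_fun (hint μ) measurableSet_Ioi
    have hz : Zf μ = 0 := by simp [hZ]
    have hN0 : N 0 = 0 := by simp [hN]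
    rw [hz, hN0] at h1
    simp only [Pi.zero_apply, zero_mul, Finset.sum_const_zero, Real.exp_zero, mul_one] at h1
    have hk : (0:ℝ) < (2 * π) ^ (-(p:ℝ)/2) := by positivity
    have h2 := h1.const_mul ((2 * π) ^ (-(p:ℝ)/2))⁻¹
    refine h2.congr (Filter.Eventually.of_forall fun x => ?_)
    simp only []
    rw [inv_mul_cancel_left₀ hk.ne']
  have hne : ¬ (h =ᵐ[volume.restrict (Ioi 0)] 0) := by
    intro hcon
    have : g =ᵐ[volume.restrict (Ioi 0)] 0 := by
      filter_upwards [hcon, ae_restrict_mem measurableSet_Ioi] with x hx hx0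
      have hx0' : 0 < x := hx0
      simp only [hh, hG, Pi.zero_apply] at hx ⊢
      have p1 : 0 < x ^ (-((p:ℝ) - 1)/2) := by positivity
      have p2 := Real.exp_pos (-((∑ i, b i ^ 2)/2) * x)
      rcases mul_eq_zero.1 hx with h3 | h3
      · rcases mul_eq_zero.1 h3 with h4 | h4
        · exact absurd h4 p1.ne'
        · exact h4
      · exact absurd h3 p2.ne'
    rw [integral_congr_ae this] at hg_pos
    simp at hg_pos
  have hlc : ∀ s, ∀ x ∈ Ioo 0 s, ∀ z ∈ Ioo 0 s, (2*z-s)^2 ≤ (2*x-s)^2 →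
      h x * h (s - x) ≤ h z * h (s - z) := by
    intro s x hx z hz hxz
    have h1 := lc_prod hG0 hg_lc hx hz hxz
    have h2 : ∀ u, h u * h (s - u) = G u * G (s - u) * Real.exp (-((∑ i, b i ^ 2)/2) * s) := by
      intro u
      rw [show -((∑ i, b i ^ 2)/2) * s = -((∑ i, b i ^ 2)/2) * u + -((∑ i, b i ^ 2)/2) * (s - u) by
        ring, Real.exp_add]
      simp only [hh]; ring
    rw [h2, h2]
    exact mul_le_mul_of_nonneg_right h1 (Real.exp_nonneg _)
  have hFp := FF_pos hm h0 hi hne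
  have hdet : 0 < |A.det|⁻¹ := by
    have : A.det ≠ 0 := hA.ne_zero
    positivity
  have hk : (0:ℝ) < (2 * π) ^ (-(p:ℝ)/2) := by positivity
  set k := Real.log (|A.det|⁻¹ * (2 * π) ^ (-(p:ℝ)/2)) with hkdef
  have hfe : ∀ y, f y = Real.exp (k + (∑ i, Zf y i * b i) + Real.log (FF h (N (Zf y)))) := by
    intro y
    rw [hf y, setIntegral_congr_fun measurableSet_Ioi (hint y), integral_const_mul,
      Real.exp_add, Real.exp_add, Real.exp_log (mul_pos hdet hk), Real.exp_log (hFp _)]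
    unfold FF
    ring
  intro y₁ y₂ θ hθ
  have hZl : Zf (θ • y₁ + (1 - θ) • y₂) = θ • Zf y₁ + (1 - θ) • Zf y₂ := by
    simp only [hZ]
    rw [← Matrix.mulVec_smul, ← Matrix.mulVec_smul, ← Matrix.mulVec_add]
    congr 1
    ext i
    simp only [Pi.sub_apply, Pi.add_apply, Pi.smul_apply, smul_eq_mul]
    ring
  have hNl : N (θ • Zf y₁ + (1 - θ) • Zf y₂) ≤ θ * N (Zf y₁) + (1 - θ) * N (Zf y₂) := by
    simp only [hN, WithLp.toLp_add, WithLp.toLp_smul]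
    refine (norm_add_le _ _).trans ?_
    rw [norm_smul, norm_smul, Real.norm_of_nonneg hθ.1.le,
      Real.norm_of_nonneg (by linarith [hθ.2] : 0 ≤ 1 - θ)]
  have hNn : ∀ z, 0 ≤ N z := fun z => norm_nonneg _
  have c1 := FF_concave hm h0 hi hne hlc (hNn (Zf y₁)) (hNn (Zf y₂)) ⟨hθ.1.le, hθ.2.le⟩
  have c2 := Real.log_le_log (hFp _) (FF_anti hm h0 hi (hNn _) hNl)
  have c3 : ∑ i, (θ • Zf y₁ + (1 - θ) • Zf y₂) i * b i =
      θ * (∑ i, Zf y₁ i * b i) + (1 - θ) * ∑ i, Zf y₂ i * b i := by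
    rw [Finset.mul_sum, Finset.mul_sum, ← Finset.sum_add_distrib]
    refine Finset.sum_congr rfl fun i _ => ?_
    simp only [Pi.add_apply, Pi.smul_apply, smul_eq_mul]
    ring
  rw [hfe, hfe, hfe, hZl, c3, ← Real.exp_mul, ← Real.exp_mul, ← Real.exp_add, Real.exp_le_exp]
  linarith
end
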